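/- arXiv:2202.08653 — 2 statements merged into one kernel-verified Lean document; each statement's English description precedes it below -/
import Mathlib

section
/- Let (S(t))_{t≥0} satisfy Assumption S. Let (f_n) ⊂ L^S_+ and f ∈ C_κ with f_n → f in the mixed topology, and suppose the sequence (A_Γ⁺f_n) is bounded above, i.e. sup_n ‖(A_Γ⁺f_n)⁺‖_κ < ∞. Then f ∈ L^S_+ and A_Γ⁺f ≤ Γ-limsup_{n→∞} A_Γ⁺f_n pointwise. -/
open Filter MeasureTheory Topology
open scoped ENNReal Topology

noncomputable section

def ecoe {X : Type*} (f : X → ℝ) : X → EReal := fun x => (f x : EReal)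

variable {X : Type*} [MetricSpace X]

/-- membership in `C_κ` -/
def MemCk (κ : X → ℝ) (f : X → ℝ) : Prop :=
  Continuous f ∧ ∃ r : ℝ, ∀ x, |f x| * κ x ≤ r

/-- `‖f‖_κ ≤ r` -/
def CkBound (κ : X → ℝ) (r : ℝ) (f : X → ℝ) : Prop := ∀ x, |f x| * κ x ≤ r

/-- extended `κ`-norm of an `EReal`-valued function -/
def eknorm (κ : X → ℝ) (f : X → EReal) : ℝ≥0∞ :=
  ⨆ x, (f x).abs * ENNReal.ofReal (κ x)

/-- positive part of an `EReal`-valued function -/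
def epos {X : Type*} (f : X → EReal) : X → EReal := fun x => max (f x) 0

/-- membership in `U_κ` -/
def MemUk (κ : X → ℝ) (f : X → EReal) : Prop :=
  UpperSemicontinuous f ∧ (∀ x, f x < ⊤) ∧
    ∃ r : ℝ, ∀ x, max (f x) 0 * (κ x : EReal) ≤ (r : EReal)

/-- `Γ`-limsup of a sequence of functions -/
def gammaLimsup (f : ℕ → X → EReal) (x : X) : EReal :=
  ⨆ (u : ℕ → X) (_ : Tendsto u atTop (𝓝 x)),
    Filter.limsup (fun n => f n (u n)) atTop

/-- `g = Γ-lim f_n` -/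
def IsGammaLim (f : ℕ → X → EReal) (g : X → EReal) : Prop :=
  ∀ x : X,
    (∀ u : ℕ → X, Tendsto u atTop (𝓝 x) →
      Filter.limsup (fun n => f n (u n)) atTop ≤ g x) ∧
    (∃ u : ℕ → X, Tendsto u atTop (𝓝 x) ∧
      Tendsto (fun n => f n (u n)) atTop (𝓝 (g x)))

/-- `Γ`-limsup as `h ↓ 0` -/
def gammaLimsupZero (F : ℝ → X → EReal) (x : X) : EReal :=
  ⨆ (h : ℕ → ℝ) (_ : ∀ n, 0 < h n) (_ : Tendsto h atTop (𝓝 (0:ℝ))),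
    gammaLimsup (fun n => F (h n)) x

/-- `Γ`-limsup as `s → t`, `s ≥ 0` -/
def gammaLimsupAt (F : ℝ → X → EReal) (t : ℝ) (x : X) : EReal :=
  ⨆ (s : ℕ → ℝ) (_ : ∀ n, 0 ≤ s n) (_ : Tendsto s atTop (𝓝 t)),
    gammaLimsup (fun n => F (s n)) x

/-- Assumption S on a family of operators on `U_κ` -/
structure AssumptionS (κ : X → ℝ) (S : ℝ → (X → EReal) → (X → EReal)) : Prop where
  monotone : ∀ t, 0 ≤ t → ∀ f g, MemUk κ f → MemUk κ g →
    (∀ x, f x ≤ g x) → ∀ x, S t f x ≤ S t g x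
  convex : ∀ t, 0 ≤ t → ∀ f g, MemUk κ f → MemUk κ g → ∀ lam : ℝ, 0 ≤ lam → lam ≤ 1 →
    ∀ x, S t (fun y => (lam : EReal) * f y + ((1 - lam : ℝ) : EReal) * g y) x
      ≤ (lam : EReal) * S t f x + ((1 - lam : ℝ) : EReal) * S t g x
  zero : ∀ t, 0 ≤ t → ∀ x, S t (fun _ => (0 : EReal)) x = 0
  maps : ∀ t, 0 ≤ t → ∀ f, MemUk κ f → MemUk κ (S t f)
  contAbove : ∀ t, 0 ≤ t → ∀ (f : ℕ → X → EReal) (g : X → EReal),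
    (∀ n, MemUk κ (f n)) → MemUk κ g →
    (∀ x, Antitone fun n => f n x) → (∀ x, (⨅ n, f n x) = g x) →
    ∀ x, (⨅ n, S t (f n) x) = S t g x
  gammaUsc : ∀ t, 0 ≤ t → ∀ f, MemUk κ f →
    ∀ x, gammaLimsupAt (fun s => S s f) t x ≤ S t f x
  idZero : ∀ f, MemUk κ f → S 0 f = f
  bounded : ∀ r t : ℝ, 0 ≤ r → 0 ≤ t → ∃ C : ℝ≥0∞, C ≠ ⊤ ∧
    ∀ s, 0 ≤ s → s ≤ t → ∀ f : X → ℝ, MemCk κ f → CkBound κ r f →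
      eknorm κ (S s (ecoe f)) ≤ C

/-- an `EReal`-valued function which belongs to `C_κ` -/
def IsCk (κ : X → ℝ) (F : X → EReal) : Prop :=
  ∃ g : X → ℝ, MemCk κ g ∧ ∀ x, F x = (g x : EReal)

/-- the upper Lipschitz set `L^S_+` -/
def UpperLip (κ : X → ℝ) (S : ℝ → (X → EReal) → (X → EReal)) (f : X → ℝ) : Prop :=
  MemCk κ f ∧
  (∀ t, 0 ≤ t → IsCk κ (S t (ecoe f))) ∧
  (∀ s t, 0 ≤ s → 0 ≤ t → S (s + t) (ecoe f) = S s (S t (ecoe f))) ∧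
  ∃ h₀ > (0:ℝ), ∃ c ≥ (0:ℝ), ∀ h, 0 ≤ h → h ≤ h₀ → ∀ x,
    max (S h (ecoe f) x - (f x : EReal)) 0 * (κ x : EReal) ≤ ((c * h : ℝ) : EReal)

/-- the (two-sided) Lipschitz set `L^S` -/
def LipSet (κ : X → ℝ) (S : ℝ → (X → EReal) → (X → EReal)) (f : X → ℝ) : Prop :=
  MemCk κ f ∧
  (∀ t, 0 ≤ t → IsCk κ (S t (ecoe f))) ∧
  (∀ s t, 0 ≤ s → 0 ≤ t → S (s + t) (ecoe f) = S s (S t (ecoe f))) ∧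
  ∃ h₀ > (0:ℝ), ∃ c ≥ (0:ℝ), ∀ h, 0 ≤ h → h ≤ h₀ → ∀ x,
    (S h (ecoe f) x - (f x : EReal)).abs * ENNReal.ofReal (κ x) ≤ ENNReal.ofReal (c * h)

/-- difference quotient `(S(h)f - f)/h` -/
def diffQuot (S : ℝ → (X → EReal) → (X → EReal)) (f : X → ℝ) (h : ℝ) : X → EReal :=
  fun x => ((h⁻¹ : ℝ) : EReal) * (S h (ecoe f) x - (f x : EReal))

/-- the upper `Γ`-generator `A_Γ⁺` -/
def uppGen (S : ℝ → (X → EReal) → (X → EReal)) (f : X → ℝ) : X → EReal :=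
  fun x => gammaLimsupZero (fun h => diffQuot S f h) x

/-- `g = A_Γ f`, i.e. the `Γ`-limit of the difference quotients exists and equals `g` -/
def IsGammaDeriv (S : ℝ → (X → EReal) → (X → EReal)) (f : X → ℝ) (g : X → EReal) : Prop :=
  ∀ h : ℕ → ℝ, (∀ n, 0 < h n) → Tendsto h atTop (𝓝 (0:ℝ)) →
    IsGammaLim (fun n => diffQuot S f (h n)) g

/-- `g = Af` in the mixed topology -/
def MixedDeriv (κ : X → ℝ) (S : ℝ → (X → EReal) → (X → EReal)) (f : X → ℝ) (g : X → ℝ) : Prop :=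
  (∃ h₀ > (0:ℝ), ∃ r : ℝ, ∀ h, 0 < h → h ≤ h₀ → ∀ x,
      |h⁻¹ * ((S h (ecoe f) x).toReal - f x)| * κ x ≤ r) ∧
  ∀ K : Set X, IsCompact K → ∀ ε > (0:ℝ), ∃ h₀ > (0:ℝ), ∀ h, 0 < h → h ≤ h₀ → ∀ x ∈ K,
    |h⁻¹ * ((S h (ecoe f) x).toReal - f x) - g x| ≤ ε

/-- upper `ε`-parallel function -/
def parallel (κ : X → ℝ) (f : X → EReal) (ε : ℝ) : X → EReal :=
  fun x => (((κ x)⁻¹ : ℝ) : EReal) *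
    ((⨆ y ∈ Metric.closedBall x ε, max (f y * (κ y : EReal)) (((-ε⁻¹ : ℝ)) : EReal)) + (ε : EReal))

/-- upper semicontinuous envelope of the upper `ε`-parallel function -/
def parallelEnv (κ : X → ℝ) (f : X → EReal) (ε : ℝ) : X → EReal :=
  fun x => ⨅ (δ : ℝ) (_ : 0 < δ), ⨆ y ∈ Metric.closedBall x δ, parallel κ f ε y

end

noncomputable section

/-- truncation of an extended real to `ℝ≥0∞` -/
def erealToENNReal (x : EReal) : ℝ≥0∞ := if x = ⊤ then ⊤ else ENNReal.ofReal x.toReal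

/-- Lebesgue integral of an `EReal`-valued function on `(a,b]`, with values in `[-∞,∞]` -/
def eIntegral (a b : ℝ) (F : ℝ → EReal) : EReal :=
  ((∫⁻ s in Set.Ioc a b, erealToENNReal (max (F s) 0)) : ℝ≥0∞) -
  ((∫⁻ s in Set.Ioc a b, erealToENNReal (max (-F s) 0)) : ℝ≥0∞)

/-- convolution `f * μ` of an `EReal`-valued function with a measure -/
def econv {X : Type*} [NormedAddCommGroup X] [MeasurableSpace X]
    (μ : Measure X) (f : X → EReal) (x : X) : EReal :=
  ((∫⁻ y, erealToENNReal (max (f (x - y)) 0) ∂μ : ℝ≥0∞) : EReal) -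
  ((∫⁻ y, erealToENNReal (max (-f (x - y)) 0) ∂μ : ℝ≥0∞) : EReal)

/-- conjugate functional `φ*` -/
def dualConj {X : Type*} [MetricSpace X] [MeasurableSpace X]
    (κ : X → ℝ) (φ : (X → ℝ) → ℝ) (μ : Measure X) : EReal :=
  ⨆ f : {g : X → ℝ // MemCk κ g}, (((∫ x, f.1 x ∂μ) : ℝ) : EReal) - ((φ f.1 : ℝ) : EReal)

/-- the topology `σ(ca_κ⁺, C_κ)` on measures -/
def weakTopo {X : Type*} [MetricSpace X] [MeasurableSpace X] (κ : X → ℝ) :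
    TopologicalSpace (Measure X) :=
  TopologicalSpace.induced
    (fun μ => fun f : {g : X → ℝ // MemCk κ g} => ∫ x, f.1 x ∂μ) Pi.topologicalSpace

/-- `φ₁`, the extension of `φ` from `C_κ` to `U_κ` -/
def extUk {X : Type*} [MetricSpace X] (κ : X → ℝ) (φ : (X → ℝ) → ℝ) (f : X → EReal) : EReal :=
  ⨅ g : {g : X → ℝ // MemCk κ g ∧ ∀ x, f x ≤ (g x : EReal)}, ((φ g.1 : ℝ) : EReal)

end


namespace S12

def UB {ι X : Type*} [TopologicalSpace X] (l : Filter ι) (F : ι → X → EReal) (G : X → EReal) :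
    Prop :=
  ∀ x, ∀ a : EReal, G x < a → ∀ᶠ p in l ×ˢ 𝓝 x, F p.1 p.2 < a

noncomputable def flim {ι X : Type*} [TopologicalSpace X] (l : Filter ι) (F : ι → X → EReal)
    (x : X) : EReal :=
  Filter.limsup (fun p : ι × X => F p.1 p.2) (l ×ˢ 𝓝 x)

lemma UB_flim {ι X : Type*} [TopologicalSpace X] (l : Filter ι) (F : ι → X → EReal) :
    UB l F (flim l F) := by
  intro x a h
  exact eventually_lt_of_limsup_lt h

lemma flim_le_of_ev {ι X : Type*} [TopologicalSpace X] {l : Filter ι} {F : ι → X → EReal}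
    {x : X} {b : EReal} (h : ∀ᶠ p in l ×ˢ 𝓝 x, F p.1 p.2 ≤ b) : flim l F x ≤ b :=
  limsup_le_of_le (by isBoundedDefault) h

lemma UB.flim_le {ι X : Type*} [TopologicalSpace X] {l : Filter ι} {F : ι → X → EReal}
    {G : X → EReal} (h : UB l F G) (x : X) : flim l F x ≤ G x := by
  refine le_of_forall_gt_imp_ge_of_dense fun a ha => ?_
  exact flim_le_of_ev ((h x a ha).mono fun p hp => hp.le)

lemma usc_flim {ι X : Type*} [TopologicalSpace X] (l : Filter ι) (F : ι → X → EReal) :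
    UpperSemicontinuous (flim l F) := by
  intro x a ha
  obtain ⟨b, hb, hba⟩ := exists_between ha
  have h1 := UB_flim l F x b hb
  rw [eventually_prod_iff] at h1
  obtain ⟨pa, hpa, pb, hpb, hh⟩ := h1
  have := eventually_eventually_nhds.2 hpb
  filter_upwards [this] with y hy
  refine lt_of_le_of_lt (flim_le_of_ev ?_) hba
  rw [eventually_prod_iff]
  exact ⟨pa, hpa, pb, hy, fun hp _ hq => (hh hp hq).le⟩

lemma UB.mono_right {ι X : Type*} [TopologicalSpace X] {l : Filter ι} {F : ι → X → EReal}
    {G G' : X → EReal} (h : UB l F G) (hG : ∀ x, G x ≤ G' x) : UB l F G' :=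
  fun x a ha => h x a ((hG x).trans_lt ha)

lemma UB.mono_left {ι X : Type*} [TopologicalSpace X] {l : Filter ι} {F F' : ι → X → EReal}
    {G : X → EReal} (h : UB l F G) (hF : ∀ᶠ i in l, ∀ x, F' i x ≤ F i x) : UB l F' G := by
  intro x a ha
  filter_upwards [h x a ha, hF.prod_inl (𝓝 x)] with p h1 h2
  exact (h2 _).trans_lt h1

lemma UB.comp {ι κ X : Type*} [TopologicalSpace X] {l : Filter ι} {l' : Filter κ}
    {F : ι → X → EReal} {G : X → EReal} (h : UB l F G) {τ : κ → ι} (hτ : Tendsto τ l' l) :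
    UB l' (fun k => F (τ k)) G := by
  intro x a ha
  have : Tendsto (fun p : κ × X => (τ p.1, p.2)) (l' ×ˢ 𝓝 x) (l ×ˢ 𝓝 x) :=
    hτ.prodMap tendsto_id
  exact this.eventually (h x a ha)

/-- sequences: `limsup` along sequences is at most the joint `limsup` -/
lemma limsup_seq_le {ι X : Type*} [TopologicalSpace X] {l : Filter ι} {F : ι → X → EReal}
    {x : X} {h : ℕ → ι} {u : ℕ → X} (hh : Tendsto h atTop l) (hu : Tendsto u atTop (𝓝 x)) :
    Filter.limsup (fun n => F (h n) (u n)) atTop ≤ flim l F x := by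
  refine le_of_forall_gt_imp_ge_of_dense fun a ha => ?_
  have h1 := (hh.prodMk hu).eventually (UB_flim l F x a ha)
  exact limsup_le_of_le (by isBoundedDefault) (h1.mono fun n hn => hn.le)

lemma exists_seq_of_lt {ι X : Type*} [MetricSpace X] {l : Filter ι} [l.IsCountablyGenerated]
    {F : ι → X → EReal} {x : X} {a : EReal} (ha : a < flim l F x) :
    ∃ (h : ℕ → ι) (u : ℕ → X), Tendsto h atTop l ∧ Tendsto u atTop (𝓝 x) ∧
      ∀ n, a < F (h n) (u n) := by
  have h1 : ∃ᶠ p in l ×ˢ 𝓝 x, a < F p.1 p.2 := frequently_lt_of_lt_limsup (by isBoundedDefault) ha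
  obtain ⟨p, hp, hp2⟩ := exists_seq_forall_of_frequently h1
  exact ⟨fun n => (p n).1, fun n => (p n).2, tendsto_fst.comp hp, tendsto_snd.comp hp, hp2⟩

lemma gammaLimsup_eq {X : Type*} [MetricSpace X] (F : ℕ → X → EReal) (x : X) :
    gammaLimsup F x = flim atTop F x := by
  apply le_antisymm
  · refine iSup₂_le fun u hu => ?_
    exact limsup_seq_le tendsto_id hu
  · refine le_of_forall_lt_imp_le_of_dense fun a ha => ?_
    obtain ⟨h, u, hh, hu, hF⟩ := exists_seq_of_lt ha
    obtain ⟨φ, hφ, hφ2⟩ := strictMono_subseq_of_tendsto_atTop hh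
    classical
    let w : ℕ → X := Function.extend (h ∘ φ) (u ∘ φ) (fun _ => x)
    have hw : ∀ k, w (h (φ k)) = u (φ k) := fun k => hφ2.injective.extend_apply (u ∘ φ) _ k
    have hwt : Tendsto w atTop (𝓝 x) := by
      intro V hV
      have h1 : ∀ᶠ k in atTop, u (φ k) ∈ V := (hu.comp hφ.tendsto_atTop) hV
      obtain ⟨K, hK⟩ := eventually_atTop.1 h1
      refine mem_map.2 (mem_atTop_sets.2 ⟨h (φ K), fun n hn => ?_⟩)
      by_cases hex : ∃ k, (h ∘ φ) k = n
      · obtain ⟨k, rfl⟩ := hex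
        have : K ≤ k := hφ2.le_iff_le.1 hn
        simp only [Set.mem_preimage, Function.comp, hw]
        exact hK k this
      · simp only [Set.mem_preimage, w, Function.extend_apply' _ _ _ hex]
        exact mem_of_mem_nhds hV
    refine le_trans ?_ (le_iSup₂_of_le w hwt le_rfl)
    refine le_limsup_of_frequently_le ?_ (by isBoundedDefault)
    have h3 : ∃ᶠ k in atTop, a ≤ F (h (φ k)) (w (h (φ k))) :=
      Frequently.of_forall fun k => by rw [hw]; exact (hF _).le
    exact hφ2.tendsto_atTop.frequently h3

lemma flim_le_gammaLimsup {X ι : Type*} [MetricSpace X] {l : Filter ι} (F : ι → X → EReal)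
    (x : X) (h : ℕ → ι) (u : ℕ → X) (hu : Tendsto u atTop (𝓝 x)) (a : EReal)
    (ha : ∀ᶠ n in atTop, a < F (h n) (u n)) : a ≤ gammaLimsup (fun n => F (h n)) x := by
  refine le_trans ?_ (le_iSup₂_of_le u hu le_rfl)
  exact le_limsup_of_frequently_le (ha.frequently.mono fun n hn => hn.le) (by isBoundedDefault)

lemma gammaLimsupZero_eq {X : Type*} [MetricSpace X] (F : ℝ → X → EReal) (x : X) :
    gammaLimsupZero F x = flim (𝓝[>] (0:ℝ)) F x := by
  apply le_antisymm
  · refine iSup_le fun h => iSup₂_le fun hpos ht => iSup₂_le fun u hu => ?_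
    exact limsup_seq_le (tendsto_nhdsWithin_iff.2 ⟨ht, Eventually.of_forall hpos⟩) hu
  · refine le_of_forall_lt_imp_le_of_dense fun a ha => ?_
    obtain ⟨h, u, hh, hu, hF⟩ := exists_seq_of_lt ha
    obtain ⟨h1, h2⟩ := tendsto_nhdsWithin_iff.1 hh
    obtain ⟨N, hN⟩ := eventually_atTop.1 h2
    refine le_trans ?_ (le_iSup_of_le (fun n => h (n + N)) (le_iSup₂_of_le
      (fun n => hN _ (Nat.le_add_left _ _)) ((tendsto_add_atTop_iff_nat N).2 h1) le_rfl))
    exact flim_le_gammaLimsup (l := 𝓝 (0:ℝ)) F x _ (fun n => u (n + N))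
      ((tendsto_add_atTop_iff_nat N).2 hu) a (Eventually.of_forall fun n => hF _)

lemma flim_le_gammaLimsupAt' {X : Type*} [MetricSpace X] (F : ℝ → X → EReal) (t : ℝ) (x : X) :
    flim (𝓝[Set.Ici (0:ℝ)] t) F x ≤ gammaLimsupAt F t x := by
  refine le_of_forall_lt_imp_le_of_dense fun a ha => ?_
  obtain ⟨h, u, hh, hu, hF⟩ := exists_seq_of_lt ha
  obtain ⟨h1, h2⟩ := tendsto_nhdsWithin_iff.1 hh
  obtain ⟨N, hN⟩ := eventually_atTop.1 h2
  refine le_trans ?_ (le_iSup_of_le (fun n => h (n + N)) (le_iSup₂_of_le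
    (fun n => hN _ (Nat.le_add_left _ _)) ((tendsto_add_atTop_iff_nat N).2 h1) le_rfl))
  exact flim_le_gammaLimsup (l := 𝓝 (0:ℝ)) F x _ (fun n => u (n + N))
    ((tendsto_add_atTop_iff_nat N).2 hu) a (Eventually.of_forall fun n => hF _)

/-- convenient form of membership in `U_κ` -/
lemma memUk_of {X : Type*} [MetricSpace X] {κ : X → ℝ} (hκ : ∀ x, 0 < κ x) {F : X → EReal}
    (hu : UpperSemicontinuous F) {r : ℝ} (hr : 0 ≤ r)
    (h : ∀ x, F x ≤ ((r / κ x : ℝ) : EReal)) : MemUk κ F := by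
  refine ⟨hu, fun x => (h x).trans_lt (EReal.coe_lt_top _), r, fun x => ?_⟩
  have h1 : max (F x) 0 ≤ ((r / κ x : ℝ) : EReal) :=
    max_le (h x) (by exact_mod_cast (div_nonneg hr (hκ x).le))
  calc max (F x) 0 * (κ x : EReal) ≤ ((r / κ x : ℝ) : EReal) * (κ x : EReal) :=
        mul_le_mul_of_nonneg_right h1 (by exact_mod_cast (hκ x).le)
    _ = (r : EReal) := by rw [← EReal.coe_mul, div_mul_cancel₀ _ (hκ x).ne']

lemma le_div_of {a : EReal} {k r : ℝ} (hk : 0 < k)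
    (h : max a 0 * (k : EReal) ≤ (r : EReal)) : a ≤ ((r / k : ℝ) : EReal) := by
  induction a with
  | bot => exact bot_le
  | top =>
    simp only [le_top, sup_of_le_left, EReal.top_mul_coe_of_pos hk] at h
    exact absurd h (by simp)
  | coe a =>
    have h2 : max (a : EReal) 0 = ((max a 0 : ℝ) : EReal) := by
      rw [EReal.coe_strictMono.monotone.map_max]; rfl
    rw [h2] at h
    have h3 : max a 0 * k ≤ r := by exact_mod_cast h
    have h4 : a ≤ r / k := by
      rw [le_div_iff₀ hk]
      exact (mul_le_mul_of_nonneg_right (le_max_left _ _) hk.le).trans h3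
    exact_mod_cast h4

lemma key {X ι : Type*} [MetricSpace X] {κ : X → ℝ} (hκc : Continuous κ) (hκ : ∀ x, 0 < κ x)
    {S : ℝ → (X → EReal) → (X → EReal)} (hS : AssumptionS κ S)
    {l : Filter ι} [l.IsCountablyGenerated] {F : ι → X → EReal} {G : X → EReal}
    {r : ℝ} (hr : 0 ≤ r) (hF : ∀ᶠ i in l, MemUk κ (F i) ∧ ∀ x, F i x ≤ ((r / κ x : ℝ) : EReal))
    (hG : MemUk κ G) (hUB : UB l F G) {τ : ι → ℝ} {t : ℝ} (ht : 0 ≤ t)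
    (hτ : Tendsto τ l (𝓝[Set.Ici (0:ℝ)] t)) :
    UB l (fun i => S (τ i) (F i)) (S t G) := by
  obtain ⟨A, hA⟩ := l.exists_antitone_basis
  set E : Set ι := {i | MemUk κ (F i) ∧ ∀ x, F i x ≤ ((r / κ x : ℝ) : EReal)} with hE
  let B : ℕ → Set ι := fun m => A m ∩ E
  have hBl : ∀ m, B m ∈ l := fun m => inter_mem (hA.1.mem_of_mem trivial) hF
  let H : ℕ → X → EReal := fun m => flim (𝓟 (B m)) F
  have hcont : Continuous fun x => ((r / κ x : ℝ) : EReal) :=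
    continuous_coe_real_ereal.comp (continuous_const.div hκc fun x => (hκ x).ne')
  have hb : ∀ l' : Filter ι, (∀ᶠ i in l', i ∈ E) → ∀ x, flim l' F x ≤ ((r / κ x : ℝ) : EReal) := by
    intro l' hl'
    apply UB.flim_le
    intro x a ha
    have h1 : ∀ᶠ y in 𝓝 x, ((r / κ y : ℝ) : EReal) < a := hcont.continuousAt.eventually_lt_const ha
    filter_upwards [hl'.prod_mk h1] with p hp
    exact (hp.1.2 _).trans_lt hp.2
  have hHU : ∀ m, MemUk κ (H m) := fun m =>
    memUk_of hκ (usc_flim _ _) hr (hb _ (by simp [B]))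
  have hLU : MemUk κ (flim l F) := memUk_of hκ (usc_flim _ _) hr (hb _ hF)
  have hanti : ∀ x, Antitone fun m => H m x := by
    intro x m n hmn
    refine limsup_le_limsup_of_le (Filter.prod_mono ?_ le_rfl)
      (by isBoundedDefault) (by isBoundedDefault)
    exact principal_mono.2 (Set.inter_subset_inter_left _ (hA.2 hmn))
  have hinf : ∀ x, (⨅ m, H m x) = flim l F x := by
    intro x
    apply le_antisymm
    · refine le_of_forall_gt_imp_ge_of_dense fun a ha => ?_
      have h1 := UB_flim l F x a ha
      rw [eventually_prod_iff] at h1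
      obtain ⟨pa, hpa, pb, hpb, hh⟩ := h1
      obtain ⟨m, -, hm⟩ := hA.1.mem_iff.1 hpa
      refine (iInf_le _ m).trans (flim_le_of_ev ?_)
      rw [eventually_prod_iff]
      exact ⟨pa, eventually_principal.2 fun i hi => hm hi.1, pb, hpb, fun hp _ hq => (hh hp hq).le⟩
    · refine le_iInf fun m => ?_
      exact limsup_le_limsup_of_le (Filter.prod_mono (le_principal_iff.2 (hBl m)) le_rfl)
        (by isBoundedDefault) (by isBoundedDefault)
  have hFH : ∀ m, ∀ i ∈ B m, ∀ x, F i x ≤ H m x := by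
    intro m i hi x
    refine le_of_forall_gt_imp_ge_of_dense fun a ha => ?_
    have h1 := UB_flim _ F x a ha
    rw [eventually_prod_iff] at h1
    obtain ⟨pa, hpa, pb, hpb, hh⟩ := h1
    exact (hh (eventually_principal.1 hpa i hi) hpb.self_of_nhds).le
  have hm : ∀ m, UB l (fun i => S (τ i) (F i)) (S t (H m)) := by
    intro m
    have h1 : UB (𝓝[Set.Ici (0:ℝ)] t) (fun s => S s (H m)) (S t (H m)) :=
      (UB_flim _ _).mono_right fun x =>
        (flim_le_gammaLimsupAt' _ t x).trans (hS.gammaUsc t ht _ (hHU m) x)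
    refine (h1.comp hτ).mono_left ?_
    filter_upwards [hBl m, hτ self_mem_nhdsWithin] with i hi hi2
    exact hS.monotone _ hi2 _ _ hi.2.1 (hHU m) (hFH m i hi)
  intro x a ha
  have h1 : (⨅ m, S t (H m) x) < a := by
    rw [hS.contAbove t ht H _ hHU hLU hanti hinf x]
    exact (hS.monotone t ht _ _ hLU hG hUB.flim_le x).trans_lt ha
  obtain ⟨m, hm'⟩ := iInf_lt_iff.1 h1
  exact hm m x a hm'


/-- real-valued version of `S s g` -/
noncomputable def rS {X : Type*} (S : ℝ → (X → EReal) → (X → EReal)) (s : ℝ) (g : X → ℝ) (x : X) :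
    ℝ := (S s (ecoe g) x).toReal

lemma ecoe_le {X : Type*} [MetricSpace X] {κ : X → ℝ} (hκ : ∀ x, 0 < κ x) {g : X → ℝ} {r : ℝ}
    (hg : CkBound κ r g) (x : X) : ecoe g x ≤ ((r / κ x : ℝ) : EReal) := by
  have : g x ≤ r / κ x := by
    rw [le_div_iff₀ (hκ x)]
    exact (mul_le_mul_of_nonneg_right (le_abs_self _) (hκ x).le).trans (hg x)
  exact EReal.coe_le_coe_iff.2 this

lemma CkBound.mono {X : Type*} [MetricSpace X] {κ : X → ℝ} {g : X → ℝ} {r r' : ℝ}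
    (hg : CkBound κ r g) (h : r ≤ r') : CkBound κ r' g := fun x => (hg x).trans h

lemma usc_ecoe {X : Type*} [MetricSpace X] {g : X → ℝ} (hg : Continuous g) :
    UpperSemicontinuous (ecoe g) :=
  (continuous_coe_real_ereal.comp hg).upperSemicontinuous

lemma memUk_ecoe {X : Type*} [MetricSpace X] {κ : X → ℝ} (hκ : ∀ x, 0 < κ x) {g : X → ℝ}
    (hg : MemCk κ g) : MemUk κ (ecoe g) := by
  obtain ⟨hc, r, hr⟩ := hg
  exact memUk_of hκ (usc_ecoe hc) (abs_nonneg r) (ecoe_le hκ (CkBound.mono hr (le_abs_self r)))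

lemma ckBound_lin {X : Type*} [MetricSpace X] {κ : X → ℝ} (hκ : ∀ x, 0 < κ x) {f g : X → ℝ}
    {r r' : ℝ} (hf : CkBound κ r f) (hg : CkBound κ r' g) (a b : ℝ) :
    CkBound κ (|a| * r + |b| * r') (fun x => a * f x + b * g x) := by
  intro x
  have h1 : |a * f x + b * g x| ≤ |a| * |f x| + |b| * |g x| := by
    rw [← abs_mul, ← abs_mul]; exact abs_add_le _ _
  calc |a * f x + b * g x| * κ x ≤ (|a| * |f x| + |b| * |g x|) * κ x :=
        mul_le_mul_of_nonneg_right h1 (hκ x).le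
    _ = |a| * (|f x| * κ x) + |b| * (|g x| * κ x) := by ring
    _ ≤ _ := add_le_add (mul_le_mul_of_nonneg_left (hf x) (abs_nonneg _))
        (mul_le_mul_of_nonneg_left (hg x) (abs_nonneg _))

lemma memCk_lin {X : Type*} [MetricSpace X] {κ : X → ℝ} (hκ : ∀ x, 0 < κ x) {f g : X → ℝ}
    (hf : MemCk κ f) (hg : MemCk κ g) (a b : ℝ) : MemCk κ (fun x => a * f x + b * g x) := by
  obtain ⟨hf, r, hr⟩ := hf
  obtain ⟨hg, r', hr'⟩ := hg
  exact ⟨by fun_prop, _, ckBound_lin hκ hr hr' a b⟩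

lemma ckBound_inv {X : Type*} [MetricSpace X] {κ : X → ℝ} (hκ : ∀ x, 0 < κ x) {r : ℝ}
    (hr : 0 ≤ r) : CkBound κ r (fun x => r / κ x) := by
  intro x
  have := hκ x
  rw [abs_of_nonneg (by positivity), div_mul_cancel₀ _ this.ne']

lemma memCk_inv {X : Type*} [MetricSpace X] {κ : X → ℝ} (hκc : Continuous κ)
    (hκ : ∀ x, 0 < κ x) {r : ℝ} (hr : 0 ≤ r) : MemCk κ (fun x => r / κ x) :=
  ⟨continuous_const.div hκc fun x => (hκ x).ne', r, ckBound_inv hκ hr⟩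

lemma rS_bd {X : Type*} [MetricSpace X] {κ : X → ℝ} (hκ : ∀ x, 0 < κ x)
    {S : ℝ → (X → EReal) → (X → EReal)} (hS : AssumptionS κ S) {r t : ℝ} (hr : 0 ≤ r)
    (ht : 0 ≤ t) : ∃ C : ℝ, 0 ≤ C ∧ ∀ s, 0 ≤ s → s ≤ t → ∀ g, MemCk κ g → CkBound κ r g → ∀ x,
      S s (ecoe g) x = (rS S s g x : EReal) ∧ |rS S s g x| ≤ C / κ x := by
  obtain ⟨C, hC, h⟩ := hS.bounded r t hr ht
  refine ⟨C.toReal, ENNReal.toReal_nonneg, fun s hs hst g hg hgb x => ?_⟩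
  have h1 : (S s (ecoe g) x).abs * ENNReal.ofReal (κ x) ≤ C :=
    (le_iSup (fun x => (S s (ecoe g) x).abs * ENNReal.ofReal (κ x)) x).trans (h s hs hst g hg hgb)
  have hk : ENNReal.ofReal (κ x) ≠ 0 := by simpa using hκ x
  unfold rS
  generalize S s (ecoe g) x = v at *
  induction v with
  | bot =>
    rw [EReal.abs_bot, ENNReal.top_mul hk] at h1
    exact absurd (top_le_iff.1 h1) hC
  | top =>
    rw [EReal.abs_top, ENNReal.top_mul hk] at h1
    exact absurd (top_le_iff.1 h1) hC
  | coe v =>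
    refine ⟨by simp, ?_⟩
    rw [EReal.abs_def, ← ENNReal.ofReal_mul (abs_nonneg _)] at h1
    rw [le_div_iff₀ (hκ x), EReal.toReal_coe]
    exact (ENNReal.ofReal_le_iff_le_toReal hC).1 h1

lemma rS_eq {X : Type*} [MetricSpace X] {κ : X → ℝ} (hκ : ∀ x, 0 < κ x)
    {S : ℝ → (X → EReal) → (X → EReal)} (hS : AssumptionS κ S) {s : ℝ} (hs : 0 ≤ s) {g : X → ℝ}
    (hg : MemCk κ g) : S s (ecoe g) = ecoe (rS S s g) := by
  obtain ⟨r, hr⟩ := hg.2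
  obtain ⟨C, -, h⟩ := rS_bd hκ hS (abs_nonneg r) hs
  funext x
  exact (h s hs le_rfl g hg (CkBound.mono hr (le_abs_self r)) x).1

lemma rS_mono {X : Type*} [MetricSpace X] {κ : X → ℝ} (hκ : ∀ x, 0 < κ x)
    {S : ℝ → (X → EReal) → (X → EReal)} (hS : AssumptionS κ S) {s : ℝ} (hs : 0 ≤ s) {f g : X → ℝ}
    (hf : MemCk κ f) (hg : MemCk κ g) (h : ∀ x, f x ≤ g x) (x : X) : rS S s f x ≤ rS S s g x := by
  have := hS.monotone s hs _ _ (memUk_ecoe hκ hf) (memUk_ecoe hκ hg)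
    (fun x => EReal.coe_le_coe_iff.2 (h x)) x
  rw [rS_eq hκ hS hs hf, rS_eq hκ hS hs hg] at this
  exact EReal.coe_le_coe_iff.1 this

lemma rS_convex {X : Type*} [MetricSpace X] {κ : X → ℝ} (hκ : ∀ x, 0 < κ x)
    {S : ℝ → (X → EReal) → (X → EReal)} (hS : AssumptionS κ S) {s : ℝ} (hs : 0 ≤ s)
    {f g k : X → ℝ} (hf : MemCk κ f) (hg : MemCk κ g) {a : ℝ} (ha : 0 ≤ a) (ha1 : a ≤ 1)
    (hk : ∀ x, k x = a * f x + (1 - a) * g x) (x : X) :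
    rS S s k x ≤ a * rS S s f x + (1 - a) * rS S s g x := by
  have hk' : k = fun x => a * f x + (1 - a) * g x := funext hk
  have hkC : MemCk κ k := hk' ▸ memCk_lin hκ hf hg a (1 - a)
  have := hS.convex s hs _ _ (memUk_ecoe hκ hf) (memUk_ecoe hκ hg) a ha ha1 x
  have h2 : (fun y => (a : EReal) * ecoe f y + ((1 - a : ℝ) : EReal) * ecoe g y) = ecoe k := by
    funext y
    simp only [ecoe, hk y]
    push_cast
    rfl
  rw [h2, rS_eq hκ hS hs hf, rS_eq hκ hS hs hg, rS_eq hκ hS hs hkC] at this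
  have h3 : ((rS S s k x : ℝ) : EReal)
      ≤ ((a * rS S s f x + (1 - a) * rS S s g x : ℝ) : EReal) := by
    rw [EReal.coe_add, EReal.coe_mul, EReal.coe_mul]
    exact this
  exact EReal.coe_le_coe_iff.1 h3

lemma rS_zero_time {X : Type*} [MetricSpace X] {κ : X → ℝ} (hκ : ∀ x, 0 < κ x)
    {S : ℝ → (X → EReal) → (X → EReal)} (hS : AssumptionS κ S) {g : X → ℝ} (hg : MemCk κ g)
    (x : X) : rS S 0 g x = g x := by
  unfold rS
  rw [hS.idZero _ (memUk_ecoe hκ hg)]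
  simp [ecoe]

lemma memCk_neg {X : Type*} [MetricSpace X] {κ : X → ℝ} {g : X → ℝ} (hg : MemCk κ g) :
    MemCk κ (fun x => - g x) := by
  obtain ⟨h, r, hr⟩ := hg
  exact ⟨h.neg, r, fun x => by rw [abs_neg]; exact hr x⟩

lemma rS_neg {X : Type*} [MetricSpace X] {κ : X → ℝ} (hκ : ∀ x, 0 < κ x)
    {S : ℝ → (X → EReal) → (X → EReal)} (hS : AssumptionS κ S) {s : ℝ} (hs : 0 ≤ s) {g : X → ℝ}
    (hg : MemCk κ g) (x : X) : - rS S s (fun y => - g y) x ≤ rS S s g x := by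
  have h := rS_convex hκ hS hs (k := fun _ => 0) hg (memCk_neg hg) (a := 1 / 2) (by norm_num)
    (by norm_num) (fun x => by ring) x
  have h0 : rS S s (fun _ => 0) x = 0 := by
    have := hS.zero s hs x
    unfold rS
    have h2 : ecoe (fun _ : X => (0:ℝ)) = fun _ => (0 : EReal) := by funext y; simp [ecoe]
    rw [h2, this]; simp
  rw [h0] at h
  linarith

lemma UB_of_tendsto {X ι : Type*} [MetricSpace X] {l : Filter ι} {g : ι → X → ℝ} {G : X → ℝ}
    (h : ∀ x, Tendsto (fun p : ι × X => g p.1 p.2) (l ×ˢ 𝓝 x) (𝓝 (G x))) :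
    UB l (fun i => ecoe (g i)) (ecoe G) := by
  intro x a ha
  have := (continuous_coe_real_ereal.tendsto (G x)).comp (h x)
  exact this.eventually_lt_const ha

lemma UB_add {X ι : Type*} [MetricSpace X] {l : Filter ι} {g : ι → X → ℝ} {G : X → ℝ}
    {F : ι → X → EReal} {H : X → EReal} (hF : UB l F H)
    (h : ∀ x, Tendsto (fun p : ι × X => g p.1 p.2) (l ×ˢ 𝓝 x) (𝓝 (G x))) :
    UB l (fun i x => ecoe (g i) x + F i x) (fun x => ecoe G x + H x) := by
  intro x a ha
  obtain ⟨c, hc, hca⟩ := EReal.lt_iff_exists_real_btwn.1 ha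
  have h1 : H x < ((c - G x : ℝ) : EReal) := by
    simp only [ecoe] at hc
    generalize H x = v at *
    induction v with
    | bot => exact EReal.bot_lt_coe _
    | top => simp at hc
    | coe v =>
      have : G x + v < c := by exact_mod_cast hc
      exact EReal.coe_lt_coe_iff.2 (by linarith)
  obtain ⟨b, hb, hb2⟩ := EReal.lt_iff_exists_real_btwn.1 h1
  have hb3 : G x < c - b := by
    have := EReal.coe_lt_coe_iff.1 hb2
    linarith
  filter_upwards [hF x b hb, (h x).eventually_lt_const hb3] with p h1 h2
  refine lt_of_le_of_lt (add_le_add le_rfl h1.le) (lt_trans ?_ hca)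
  have : g p.1 p.2 + b < c := by linarith
  simp only [ecoe]
  exact_mod_cast this

/-- one-sided estimate used for mixed continuity -/
lemma half {X : Type*} [MetricSpace X] {κ : X → ℝ} (hκc : Continuous κ) (hκ : ∀ x, 0 < κ x)
    {S : ℝ → (X → EReal) → (X → EReal)} (hS : AssumptionS κ S) {t : ℝ} (ht : 0 ≤ t)
    {a b : ℕ → X → ℝ} {g : X → ℝ} {r : ℝ} (hr : 0 ≤ r) (ha : ∀ n, MemCk κ (a n))
    (hb : ∀ n, MemCk κ (b n)) (hg : MemCk κ g) (har : ∀ n, CkBound κ r (a n))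
    (hbr : ∀ n, CkBound κ r (b n))
    (hag : ∀ x, Tendsto (fun p : ℕ × X => a p.1 p.2) (atTop ×ˢ 𝓝 x) (𝓝 (g x)))
    (hbg : ∀ x, Tendsto (fun p : ℕ × X => b p.1 p.2) (atTop ×ˢ 𝓝 x) (𝓝 (g x)))
    (x : X) {ε : ℝ} (hε : 0 < ε) :
    ∀ᶠ p in atTop ×ˢ 𝓝 x, rS S t (a p.1) p.2 - rS S t (b p.1) p.2 < ε := by
  obtain ⟨C, hC0, hC⟩ := rS_bd hκ hS hr ht
  set D : ℝ := |rS S t g x + 1| + C / κ x + 1 with hD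
  have hDpos : 0 < D := by
    have := hκ x
    positivity
  set lam : ℝ := min 1 (ε / (2 * D)) with hlam
  have hl0 : 0 < lam := by positivity
  have hl1 : lam ≤ 1 := min_le_left _ _
  have hlD : lam * D < ε := by
    have : lam ≤ ε / (2 * D) := min_le_right _ _
    calc lam * D ≤ ε / (2 * D) * D := mul_le_mul_of_nonneg_right this hDpos.le
      _ = ε / 2 := by field_simp
      _ < ε := by linarith
  let c : ℕ → X → ℝ := fun n y => lam⁻¹ * a n y + (1 - lam⁻¹) * b n y
  have hc : ∀ n, MemCk κ (c n) := fun n => memCk_lin hκ (ha n) (hb n) _ _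
  have hcr : ∀ n, CkBound κ (|lam⁻¹| * r + |1 - lam⁻¹| * r) (c n) :=
    fun n => ckBound_lin hκ (har n) (hbr n) _ _
  have hcg : ∀ x, Tendsto (fun p : ℕ × X => c p.1 p.2) (atTop ×ˢ 𝓝 x) (𝓝 (g x)) := by
    intro x
    have := ((hag x).const_mul lam⁻¹).add ((hbg x).const_mul (1 - lam⁻¹))
    convert this using 2
    ring
  have hk := key hκc hκ hS (l := atTop) (F := fun n => ecoe (c n)) (G := ecoe g)
    (r := |lam⁻¹| * r + |1 - lam⁻¹| * r) (by positivity)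
    (Eventually.of_forall fun n => ⟨memUk_ecoe hκ (hc n), ecoe_le hκ (hcr n)⟩)
    (memUk_ecoe hκ hg) (UB_of_tendsto hcg) (τ := fun _ => t) ht
    (tendsto_nhdsWithin_iff.2 ⟨tendsto_const_nhds, Eventually.of_forall fun _ => ht⟩)
  have h1 := hk x ((rS S t g x + 1 : ℝ) : EReal) (by
    rw [rS_eq hκ hS ht hg]; exact EReal.coe_lt_coe_iff.2 (by linarith))
  have h2 : ∀ᶠ y in 𝓝 x, C / κ y < C / κ x + 1 := by
    have : Continuous fun y => C / κ y := continuous_const.div hκc fun x => (hκ x).ne'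
    exact this.continuousAt.eventually_lt_const (by linarith)
  filter_upwards [h1, h2.prod_inr atTop] with p hp1 hp2
  rw [rS_eq hκ hS ht (hc _)] at hp1
  have hp3 : rS S t (c p.1) p.2 < rS S t g x + 1 := EReal.coe_lt_coe_iff.1 hp1
  have hp4 := (abs_le.1 (hC t ht le_rfl _ (hb p.1) (hbr p.1) p.2).2).1
  have hp5 := rS_convex hκ hS ht (k := a p.1) (hc p.1) (hb p.1) hl0.le hl1
    (fun y => by simp only [c]; field_simp; ring) p.2
  have hp6 : rS S t (c p.1) p.2 - rS S t (b p.1) p.2 ≤ D := by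
    have := le_abs_self (rS S t g x + 1)
    linarith
  have := mul_le_mul_of_nonneg_left hp6 hl0.le
  nlinarith


lemma mix0 {X : Type*} [MetricSpace X] {κ : X → ℝ} (hκc : Continuous κ) (hκ : ∀ x, 0 < κ x)
    {S : ℝ → (X → EReal) → (X → EReal)} (hS : AssumptionS κ S) {t : ℝ} (ht : 0 ≤ t)
    {a : ℕ → X → ℝ} {g : X → ℝ} {r : ℝ} (ha : ∀ n, MemCk κ (a n))
    (hg : MemCk κ g) (har : ∀ n, CkBound κ r (a n))
    (hag : ∀ x, Tendsto (fun p : ℕ × X => a p.1 p.2) (atTop ×ˢ 𝓝 x) (𝓝 (g x))) (x : X) :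
    Tendsto (fun p : ℕ × X => rS S t (a p.1) p.2 - rS S t g p.2) (atTop ×ˢ 𝓝 x) (𝓝 0) := by
  obtain ⟨r', hr'⟩ := hg.2
  set R : ℝ := max |r| |r'|
  have hR : 0 ≤ R := (abs_nonneg r).trans (le_max_left _ _)
  have h1 : ∀ n, CkBound κ R (a n) :=
    fun n => CkBound.mono (har n) ((le_abs_self r).trans (le_max_left _ _))
  have h2 : CkBound κ R g := CkBound.mono hr' ((le_abs_self r').trans (le_max_right _ _))
  have hgg : ∀ x, Tendsto (fun p : ℕ × X => g p.2) (atTop ×ˢ 𝓝 x) (𝓝 (g x)) :=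
    fun x => (hg.1.tendsto x).comp tendsto_snd
  rw [Metric.tendsto_nhds]
  intro ε hε
  filter_upwards [half hκc hκ hS ht hR ha (fun _ => hg) hg h1 (fun _ => h2) hag hgg x hε,
    half hκc hκ hS ht hR (fun _ => hg) ha hg (fun _ => h2) h1 hgg hag x hε] with p hp1 hp2
  rw [Real.dist_eq, sub_zero, abs_lt]
  constructor <;> linarith

lemma mix_pt {X : Type*} [MetricSpace X] {κ : X → ℝ} (hκc : Continuous κ) (hκ : ∀ x, 0 < κ x)
    {S : ℝ → (X → EReal) → (X → EReal)} (hS : AssumptionS κ S) {t : ℝ} (ht : 0 ≤ t)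
    {a : ℕ → X → ℝ} {g : X → ℝ} {r : ℝ} (ha : ∀ n, MemCk κ (a n))
    (hg : MemCk κ g) (har : ∀ n, CkBound κ r (a n))
    (hag : ∀ x, Tendsto (fun p : ℕ × X => a p.1 p.2) (atTop ×ˢ 𝓝 x) (𝓝 (g x))) (x : X) :
    Tendsto (fun n => rS S t (a n) x) atTop (𝓝 (rS S t g x)) := by
  have h := (mix0 hκc hκ hS ht ha hg har hag x).comp
    (tendsto_id.prodMk (tendsto_const_nhds (x := x) (f := atTop)))
  have := h.add_const (rS S t g x)
  simpa [Function.comp_def] using this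

lemma mix_cont {X : Type*} [MetricSpace X] {κ : X → ℝ} (hκc : Continuous κ) (hκ : ∀ x, 0 < κ x)
    {S : ℝ → (X → EReal) → (X → EReal)} (hS : AssumptionS κ S) {t : ℝ} (ht : 0 ≤ t)
    {a : ℕ → X → ℝ} {g : X → ℝ} {r : ℝ} (ha : ∀ n, MemCk κ (a n))
    (hg : MemCk κ g) (har : ∀ n, CkBound κ r (a n))
    (hag : ∀ x, Tendsto (fun p : ℕ × X => a p.1 p.2) (atTop ×ˢ 𝓝 x) (𝓝 (g x)))
    (hc : ∀ n, Continuous (rS S t (a n))) : Continuous (rS S t g) ∧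
    ∀ x, Tendsto (fun p : ℕ × X => rS S t (a p.1) p.2) (atTop ×ˢ 𝓝 x) (𝓝 (rS S t g x)) := by
  have h0 := mix0 hκc hκ hS ht ha hg har hag
  have hcont : Continuous (rS S t g) := by
    have : TendstoLocallyUniformly (fun n => rS S t (a n)) (rS S t g) atTop := by
      rw [tendstoLocallyUniformly_iff_forall_tendsto]
      intro x
      rw [tendsto_uniformity_iff_dist_tendsto_zero]
      have := (h0 x).abs
      simp only [abs_zero] at this
      refine this.congr fun p => ?_
      rw [dist_comm, Real.dist_eq]
    exact this.continuous (Eventually.of_forall hc).frequently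
  refine ⟨hcont, fun x => ?_⟩
  have := (h0 x).add ((hcont.tendsto x).comp (tendsto_snd (f := (atTop : Filter ℕ))))
  simpa [Function.comp_def] using this

lemma joint_of_unif {X : Type*} [MetricSpace X] {fn : ℕ → X → ℝ} {f : X → ℝ} (hf : Continuous f)
    (hunif : ∀ K : Set X, IsCompact K → TendstoUniformlyOn (fun n => fn n) f atTop K) (x : X) :
    Tendsto (fun p : ℕ × X => fn p.1 p.2) (atTop ×ˢ 𝓝 x) (𝓝 (f x)) := by
  refine tendsto_of_seq_tendsto fun p hp => ?_
  have h1 : Tendsto (fun k => (p k).1) atTop atTop := tendsto_fst.comp hp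
  have h2 : Tendsto (fun k => (p k).2) atTop (𝓝 x) := tendsto_snd.comp hp
  have hK := hunif _ h2.isCompact_insert_range
  rw [Metric.tendstoUniformlyOn_iff] at hK
  have h3 : Tendsto (fun k => f (p k).2) atTop (𝓝 (f x)) := (hf.tendsto x).comp h2
  rw [Metric.tendsto_nhds] at h3 ⊢
  intro ε hε
  filter_upwards [h3 (ε / 2) (by linarith), h1.eventually (hK (ε / 2) (by linarith))] with k hk1 hk2
  have := hk2 (p k).2 (Set.mem_insert_of_mem _ ⟨k, rfl⟩)
  rw [dist_comm] at this
  have h4 := dist_triangle (fn (p k).1 (p k).2) (f (p k).2) (f x)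
  exact h4.trans_lt (by linarith)

lemma mvt {u : ℝ → ℝ} {T K M δ : ℝ} (hδ : 0 < δ)
    (hK : ∀ s, 0 ≤ s → s < T → ∀ h, 0 ≤ h → h ≤ δ → u (s + h) ≤ u s + K * h)
    (hM : ∀ s, 0 ≤ s → s < T → ∀ᶠ h in 𝓝[>] (0:ℝ), u (s + h) ≤ u s + M * h)
    {t : ℝ} (ht : 0 ≤ t) (htT : t ≤ T) : u t ≤ u 0 + M * t := by
  set A : Set ℝ := {t | 0 ≤ t ∧ t ≤ T ∧ ∀ s, 0 ≤ s → s ≤ t → u s ≤ u 0 + M * s} with hA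
  have h0 : (0:ℝ) ∈ A := by
    refine ⟨le_rfl, ht.trans htT, fun s hs hs' => ?_⟩
    have : s = 0 := le_antisymm hs' hs
    subst this; simp
  have hbdd : BddAbove A := ⟨T, fun s hs => hs.2.1⟩
  set σ := sSup A with hσ
  have hσ0 : 0 ≤ σ := le_csSup hbdd h0
  have hσT : σ ≤ T := csSup_le ⟨0, h0⟩ fun s hs => hs.2.1
  have hlt : ∀ s, 0 ≤ s → s < σ → u s ≤ u 0 + M * s := by
    intro s hs hs'
    obtain ⟨a, ha, hsa⟩ := exists_lt_of_lt_csSup ⟨0, h0⟩ hs'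
    exact ha.2.2 s hs hsa.le
  have hσP : u σ ≤ u 0 + M * σ := by
    rcases hσ0.eq_or_lt with h | h
    · rw [← h]; simp
    · have hc : Tendsto (fun s => u 0 + M * s + K * (σ - s)) (𝓝[<] σ)
          (𝓝 (u 0 + M * σ + K * (σ - σ))) := by
        apply Tendsto.mono_left _ nhdsWithin_le_nhds
        exact Continuous.tendsto (by fun_prop) σ
      rw [sub_self, mul_zero, add_zero] at hc
      refine ge_of_tendsto hc ?_
      have h1 : Set.Ioo (max 0 (σ - δ)) σ ∈ 𝓝[<] σ :=
        Ioo_mem_nhdsLT (max_lt h (by linarith))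
      filter_upwards [h1] with s hs
      have hs0 : 0 ≤ s := (le_max_left _ _).trans hs.1.le
      have hs1 : σ - δ < s := (le_max_right _ _).trans_lt hs.1
      have := hK s hs0 (hs.2.trans_le hσT) (σ - s) (by linarith [hs.2]) (by linarith)
      rw [add_sub_cancel] at this
      linarith [hlt s hs0 hs.2]
  have hle : ∀ s, 0 ≤ s → s ≤ σ → u s ≤ u 0 + M * s := by
    intro s hs hs'
    rcases hs'.eq_or_lt with h | h
    · rw [h]; exact hσP
    · exact hlt s hs h
  have hσeq : σ = T := by
    by_contra hne
    have hlt' : σ < T := lt_of_le_of_ne hσT hne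
    have h1 := hM σ hσ0 hlt'
    obtain ⟨d, hd, hd2⟩ := mem_nhdsGT_iff_exists_Ioo_subset.1 h1
    have hd0 : (0:ℝ) < d := hd
    set e := min (d / 2) (T - σ) with he
    have he0 : 0 < e := lt_min (by linarith) (by linarith)
    have hed : e < d := (min_le_left _ _).trans_lt (by linarith)
    have : σ + e ∈ A := by
      refine ⟨by linarith, by linarith [min_le_right (d / 2) (T - σ)], fun s hs hs' => ?_⟩
      rcases le_or_gt s σ with h | h
      · exact hle s hs h
      · have h2 : u (σ + (s - σ)) ≤ u σ + M * (s - σ) :=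
          hd2 (show s - σ ∈ Set.Ioo 0 d from ⟨by linarith, by linarith⟩)
        rw [add_sub_cancel] at h2
        linarith
    have := le_csSup hbdd this
    linarith
  exact hle t ht (hσeq ▸ htT)

/-- facts about an element of the upper Lipschitz set -/
lemma upperLip_memCk {X : Type*} [MetricSpace X] {κ : X → ℝ}
    {S : ℝ → (X → EReal) → (X → EReal)} {f : X → ℝ} (hf : UpperLip κ S f) {t : ℝ} (ht : 0 ≤ t) :
    MemCk κ (rS S t f) := by
  obtain ⟨g, hg, h⟩ := hf.2.1 t ht
  have : rS S t f = g := by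
    funext x
    simp [rS, h x]
  exact this ▸ hg

lemma upperLip_semi {X : Type*} [MetricSpace X] {κ : X → ℝ} (hκ : ∀ x, 0 < κ x)
    {S : ℝ → (X → EReal) → (X → EReal)} (hS : AssumptionS κ S) {f : X → ℝ}
    (hf : UpperLip κ S f) {s t : ℝ} (hs : 0 ≤ s) (ht : 0 ≤ t) (x : X) :
    rS S (s + t) f x = rS S s (rS S t f) x := by
  unfold rS
  rw [hf.2.2.1 s t hs ht, rS_eq hκ hS ht hf.1]
  rfl

/-- the function `f + (S(h) f - f)/h` -/
noncomputable def qf {X : Type*} (S : ℝ → (X → EReal) → (X → EReal)) (f : X → ℝ) (h : ℝ) (x : X) :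
    ℝ := h⁻¹ * rS S h f x + (1 - h⁻¹) * f x

lemma qf_step {X : Type*} [MetricSpace X] {κ : X → ℝ} (hκ : ∀ x, 0 < κ x)
    {S : ℝ → (X → EReal) → (X → EReal)} (hS : AssumptionS κ S) {f : X → ℝ}
    (hf : UpperLip κ S f) {s h : ℝ} (hs : 0 ≤ s) (hh : 0 < h) (hh1 : h ≤ 1) (x : X) :
    rS S (s + h) f x ≤ rS S s f x + (rS S s (qf S f h) x - rS S s f x) * h := by
  rw [upperLip_semi hκ hS hf hs hh.le]
  have := rS_convex hκ hS hs (k := rS S h f) (f := qf S f h) (g := f)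
    (memCk_lin hκ (upperLip_memCk hf hh.le) hf.1 _ _) hf.1 hh.le hh1
    (fun y => by unfold qf; field_simp; ring) x
  linarith

lemma qf_bd {X : Type*} [MetricSpace X] {κ : X → ℝ} (hκ : ∀ x, 0 < κ x)
    {S : ℝ → (X → EReal) → (X → EReal)} (hS : AssumptionS κ S) {f : X → ℝ}
    (hf : UpperLip κ S f) : ∃ h₀ > 0, h₀ ≤ 1 ∧ ∃ r ≥ (0:ℝ), ∀ h, 0 < h → h ≤ h₀ → ∀ x,
      qf S f h x ≤ r / κ x := by
  obtain ⟨h₀, hh₀, c, hc, H⟩ := hf.2.2.2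
  obtain ⟨r, hr⟩ := hf.1.2
  refine ⟨min h₀ 1, lt_min hh₀ one_pos, min_le_right _ _, |r| + c, by positivity,
    fun h hh hh' x => ?_⟩
  have h1 := le_div_of (hκ x) (H h hh.le (hh'.trans (min_le_left _ _)) x)
  rw [rS_eq hκ hS hh.le hf.1] at h1
  have h2 : rS S h f x - f x ≤ c * h / κ x := by
    have : ((rS S h f x - f x : ℝ) : EReal) ≤ ((c * h / κ x : ℝ) : EReal) := by
      rw [EReal.coe_sub]; exact h1
    exact EReal.coe_le_coe_iff.1 this
  have h3 : f x ≤ |r| / κ x := by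
    rw [le_div_iff₀ (hκ x)]
    exact (mul_le_mul_of_nonneg_right (le_abs_self _) (hκ x).le).trans
      ((hr x).trans (le_abs_self r))
  have h4 : h⁻¹ * (rS S h f x - f x) ≤ h⁻¹ * (c * h / κ x) :=
    mul_le_mul_of_nonneg_left h2 (inv_pos.2 hh).le
  have h5 : h⁻¹ * (c * h / κ x) = c / κ x := by field_simp
  rw [add_div]
  unfold qf
  nlinarith

lemma qf_memCk {X : Type*} [MetricSpace X] {κ : X → ℝ} (hκ : ∀ x, 0 < κ x)
    {S : ℝ → (X → EReal) → (X → EReal)} {f : X → ℝ}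
    (hf : UpperLip κ S f) {h : ℝ} (hh : 0 < h) : MemCk κ (qf S f h) :=
  memCk_lin hκ (upperLip_memCk hf hh.le) hf.1 _ _

lemma upperLip_K {X : Type*} [MetricSpace X] {κ : X → ℝ} (hκc : Continuous κ) (hκ : ∀ x, 0 < κ x)
    {S : ℝ → (X → EReal) → (X → EReal)} (hS : AssumptionS κ S) {f : X → ℝ}
    (hf : UpperLip κ S f) (x : X) : ∃ δ > 0, ∃ K : ℝ, ∀ s, 0 ≤ s → s < 1 → ∀ h, 0 ≤ h → h ≤ δ →
      rS S (s + h) f x ≤ rS S s f x + K * h := by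
  obtain ⟨h₀, hh₀, hh1, r, hr, H⟩ := qf_bd hκ hS hf
  obtain ⟨r', hr'⟩ := hf.1.2
  obtain ⟨C, hC0, hC⟩ := rS_bd hκ hS hr zero_le_one
  obtain ⟨C', hC0', hC'⟩ := rS_bd hκ hS (abs_nonneg r') zero_le_one
  refine ⟨h₀, hh₀, C / κ x + C' / κ x, fun s hs hs1 h hh hhh => ?_⟩
  rcases hh.eq_or_lt with h0 | h0
  · rw [← h0]; simp
  have h1 := qf_step hκ hS hf hs h0 (hhh.trans hh1) x
  have h2 := rS_mono hκ hS hs (qf_memCk hκ hf h0) (memCk_inv hκc hκ hr) (H h h0 hhh) x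
  have h3 := (abs_le.1 (hC s hs hs1.le _ (memCk_inv hκc hκ hr) (ckBound_inv hκ hr) x).2).2
  have h4 := (abs_le.1 (hC' s hs hs1.le _ hf.1 (CkBound.mono hr' (le_abs_self r')) x).2).1
  have h5 : (rS S s (qf S f h) x - rS S s f x) * h ≤ (C / κ x + C' / κ x) * h :=
    mul_le_mul_of_nonneg_right (by linarith) hh
  linarith

lemma dini {X : Type*} [MetricSpace X] {κ : X → ℝ} (hκc : Continuous κ) (hκ : ∀ x, 0 < κ x)
    {S : ℝ → (X → EReal) → (X → EReal)} (hS : AssumptionS κ S) {f : X → ℝ}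
    (hf : UpperLip κ S f) {Φ : X → EReal} (hΦ : MemUk κ Φ)
    (hΦf : ∀ x, ecoe f x + uppGen S f x ≤ Φ x) {s M : ℝ} (hs : 0 ≤ s) (x : X)
    (hM : S s Φ x < ((M + rS S s f x : ℝ) : EReal)) :
    ∀ᶠ h in 𝓝[>] (0:ℝ), rS S (s + h) f x ≤ rS S s f x + M * h := by
  obtain ⟨h₀, hh₀, hh1, r, hr, H⟩ := qf_bd hκ hS hf
  have hI : Set.Ioc 0 h₀ ∈ 𝓝[>] (0:ℝ) := Ioc_mem_nhdsGT hh₀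
  have hUB0 : UB (𝓝[>] (0:ℝ)) (fun h => diffQuot S f h) (uppGen S f) :=
    (UB_flim _ _).mono_right fun x => (gammaLimsupZero_eq _ x).ge
  have hUB1 := UB_add hUB0 (g := fun _ => f) (G := f)
    (fun x => (hf.1.1.tendsto x).comp tendsto_snd)
  have hUB2 : UB (𝓝[>] (0:ℝ)) (fun h => ecoe (qf S f h)) Φ := by
    refine (hUB1.mono_right hΦf).mono_left ?_
    filter_upwards [hI] with h hh x
    have hh0 : h ≠ 0 := hh.1.ne'
    have e : qf S f h x = f x + h⁻¹ * (rS S h f x - f x) := by unfold qf; ring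
    simp only [diffQuot, rS_eq hκ hS hh.1.le hf.1]
    simp only [ecoe, e]
    push_cast
    exact le_rfl
  have hk := key hκc hκ hS (l := 𝓝[>] (0:ℝ)) hr (by
    filter_upwards [hI] with h hh
    exact ⟨memUk_ecoe hκ (qf_memCk hκ hf hh.1), fun x =>
      EReal.coe_le_coe_iff.2 (H h hh.1 hh.2 x)⟩) hΦ hUB2 (τ := fun _ => s) hs
    (tendsto_nhdsWithin_iff.2 ⟨tendsto_const_nhds, Eventually.of_forall fun _ => hs⟩)
  have h1 := hk x _ hM
  have h2 : ∀ᶠ h in 𝓝[>] (0:ℝ), S s (ecoe (qf S f h)) x < ((M + rS S s f x : ℝ) : EReal) :=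
    (tendsto_id.prodMk (tendsto_const_nhds (x := x))).eventually h1
  filter_upwards [h2, hI] with h hh2 hh
  rw [rS_eq hκ hS hs (qf_memCk hκ hf hh.1)] at hh2
  have h3 := EReal.coe_lt_coe_iff.1 hh2
  have h4 := qf_step hκ hS hf hs hh.1 (hh.2.trans hh1) x
  have : (rS S s (qf S f h) x - rS S s f x) * h ≤ M * h :=
    mul_le_mul_of_nonneg_right (by linarith) hh.1.le
  linarith

/-- integrated version -/
lemma growth {X : Type*} [MetricSpace X] {κ : X → ℝ} (hκc : Continuous κ) (hκ : ∀ x, 0 < κ x)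
    {S : ℝ → (X → EReal) → (X → EReal)} (hS : AssumptionS κ S) {f : X → ℝ}
    (hf : UpperLip κ S f) {Φ : X → EReal} (hΦ : MemUk κ Φ)
    (hΦf : ∀ x, ecoe f x + uppGen S f x ≤ Φ x) {T M : ℝ} (hT : T ≤ 1) (x : X)
    (hM : ∀ s, 0 ≤ s → s < T → S s Φ x < ((M + rS S s f x : ℝ) : EReal))
    {t : ℝ} (ht : 0 ≤ t) (htT : t ≤ T) : rS S t f x ≤ f x + M * t := by
  obtain ⟨δ, hδ, K, hK⟩ := upperLip_K hκc hκ hS hf x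
  have := mvt (u := fun s => rS S s f x) (T := T) (K := K) (M := M) hδ
    (fun s hs hsT => hK s hs (hsT.trans_le hT))
    (fun s hs hsT => dini hκc hκ hS hf hΦ hΦf hs x (hM s hs hsT)) ht htT
  simpa [rS_zero_time hκ hS hf.1] using this

end S12

/-- stability of `L^S_+` and upper bound for the upper `Γ`-generator
under mixed-topology approximation. -/
theorem stmt12
    {X : Type*} [MetricSpace X] [CompleteSpace X] [TopologicalSpace.SeparableSpace X]
    (κ : X → ℝ) (hκc : Continuous κ) (hκpos : ∀ x, 0 < κ x) (hκbd : ∃ C, ∀ x, κ x ≤ C)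
    (S : ℝ → (X → EReal) → (X → EReal)) (hS : AssumptionS κ S)
    (fn : ℕ → X → ℝ) (f : X → ℝ)
    (hfn : ∀ n, UpperLip κ S (fn n)) (hfC : MemCk κ f)
    (hbd : ∃ r : ℝ, ∀ n, CkBound κ r (fn n))
    (hunif : ∀ K : Set X, IsCompact K → TendstoUniformlyOn (fun n => fn n) f atTop K)
    (hgenbd : ∃ r : ℝ, ∀ n x, max (uppGen S (fn n) x) 0 * (κ x : EReal) ≤ (r : EReal)) :
    UpperLip κ S f ∧ ∀ x, uppGen S f x ≤ gammaLimsup (fun n => uppGen S (fn n)) x := by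
  classical
  obtain ⟨r0, hr0⟩ := hbd
  obtain ⟨r1, hr1⟩ := hgenbd
  have hfnC : ∀ n, MemCk κ (fn n) := fun n => (hfn n).1
  have hbd' : ∀ n, CkBound κ |r0| (fn n) := fun n => S12.CkBound.mono (hr0 n) (le_abs_self r0)
  have hjoint := fun x => S12.joint_of_unif hfC.1 hunif x
  have hgen : ∀ n x, uppGen S (fn n) x ≤ ((|r1| / κ x : ℝ) : EReal) := fun n x =>
    (S12.le_div_of (hκpos x) (hr1 n x)).trans (EReal.coe_le_coe_iff.2
      (div_le_div_of_nonneg_right (le_abs_self r1) (hκpos x).le))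
  have husc : ∀ n, UpperSemicontinuous (uppGen S (fn n)) := fun n => by
    have : uppGen S (fn n) = S12.flim (𝓝[>] (0:ℝ)) (fun h => diffQuot S (fn n) h) :=
      funext fun x => S12.gammaLimsupZero_eq _ x
    rw [this]; exact S12.usc_flim _ _
  set R : ℝ := |r0| + |r1| with hR
  have hR0 : 0 ≤ R := by positivity
  have hsum : ∀ (g : X → ℝ) (A : X → EReal), Continuous g → UpperSemicontinuous A →
      (∀ x, A x < ⊤) → UpperSemicontinuous fun x => ecoe g x + A x := by
    intro g A hg hA hAt
    refine UpperSemicontinuous.add' (S12.usc_ecoe hg) hA fun x => ?_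
    exact EReal.continuousAt_add (Or.inl (EReal.coe_ne_top _)) (Or.inl (EReal.coe_ne_bot _))
  let Φ : ℕ → X → EReal := fun n x => ecoe (fn n) x + uppGen S (fn n) x
  have hΦle : ∀ n x, Φ n x ≤ ((R / κ x : ℝ) : EReal) := by
    intro n x
    have := add_le_add (S12.ecoe_le hκpos (hbd' n) x) (hgen n x)
    rw [← EReal.coe_add, ← add_div] at this
    exact this
  have hΦU : ∀ n, MemUk κ (Φ n) := fun n =>
    S12.memUk_of hκpos (hsum _ _ (hfnC n).1 (husc n)
      fun x => (hgen n x).trans_lt (EReal.coe_lt_top _)) hR0 (hΦle n)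
  have hpt : ∀ t, 0 ≤ t → ∀ x,
      Tendsto (fun n => S12.rS S t (fn n) x) atTop (𝓝 (S12.rS S t f x)) := fun t ht x =>
    S12.mix_pt hκc hκpos hS ht hfnC hfC hbd' hjoint x
  have hCkf : ∀ t, 0 ≤ t → MemCk κ (S12.rS S t f) ∧ ∀ x, Tendsto
      (fun p : ℕ × X => S12.rS S t (fn p.1) p.2) (atTop ×ˢ 𝓝 x) (𝓝 (S12.rS S t f x)) := by
    intro t ht
    obtain ⟨h1, h2⟩ := S12.mix_cont hκc hκpos hS ht hfnC hfC hbd' hjoint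
      (fun n => (S12.upperLip_memCk (hfn n) ht).1)
    obtain ⟨r, hr⟩ := hfC.2
    obtain ⟨C, hC0, hC⟩ := S12.rS_bd hκpos hS (abs_nonneg r) ht
    refine ⟨⟨h1, C, fun x => ?_⟩, h2⟩
    exact (le_div_iff₀ (hκpos x)).1
      (hC t ht le_rfl f hfC (S12.CkBound.mono hr (le_abs_self r)) x).2
  refine ⟨⟨hfC, ?_, ?_, ?_⟩, ?_⟩
  · intro t ht
    exact ⟨_, (hCkf t ht).1, fun x => congrFun (S12.rS_eq hκpos hS ht hfC) x⟩
  · intro s t hs ht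
    obtain ⟨C, hC0, hC⟩ := S12.rS_bd hκpos hS (abs_nonneg r0) ht
    have h1 : ∀ x, Tendsto (fun n => S12.rS S s (S12.rS S t (fn n)) x) atTop
        (𝓝 (S12.rS S s (S12.rS S t f) x)) :=
      S12.mix_pt hκc hκpos hS hs (fun n => S12.upperLip_memCk (hfn n) ht) (hCkf t ht).1 (r := C)
        (fun n x => (le_div_iff₀ (hκpos x)).1 (hC t ht le_rfl _ (hfnC n) (hbd' n) x).2)
        (hCkf t ht).2
    rw [S12.rS_eq hκpos hS (add_nonneg hs ht) hfC, S12.rS_eq hκpos hS ht hfC,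
      S12.rS_eq hκpos hS hs (hCkf t ht).1]
    congr 1
    funext x
    refine tendsto_nhds_unique (hpt (s + t) (add_nonneg hs ht) x) ?_
    refine (h1 x).congr fun n => ?_
    exact (S12.upperLip_semi hκpos hS (hfn n) hs ht x).symm
  · obtain ⟨C, hC0, hC⟩ := S12.rS_bd hκpos hS hR0 zero_le_one
    refine ⟨1, one_pos, 2 * C + 1, by positivity, fun h hh hh1 x => ?_⟩
    have hk := hκpos x
    have hn : ∀ n, S12.rS S h (fn n) x ≤ fn n x + (2 * C + 1) / κ x * h := by
      intro n
      refine S12.growth hκc hκpos hS (hfn n) (hΦU n) (fun _ => le_rfl) (T := 1) le_rfl x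
        (fun s hs hs1 => ?_) hh hh1
      have hi := S12.memCk_inv hκc hκpos hR0
      have h1 := hS.monotone s hs _ _ (hΦU n) (S12.memUk_ecoe hκpos hi) (hΦle n) x
      rw [S12.rS_eq hκpos hS hs hi] at h1
      refine h1.trans_lt (EReal.coe_lt_coe_iff.2 ?_)
      have h2 := (abs_le.1 (hC s hs hs1.le _ hi (S12.ckBound_inv hκpos hR0) x).2).2
      have h3 := (abs_le.1 (hC s hs hs1.le _ (hfnC n)
        (S12.CkBound.mono (hbd' n) (by simp [hR])) x).2).1
      have h4 : (2 * C + 1) / κ x = C / κ x + C / κ x + 1 / κ x := by ring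
      have h5 : 0 < 1 / κ x := by positivity
      rw [h4]
      linarith
    have hlim : S12.rS S h f x ≤ f x + (2 * C + 1) / κ x * h := by
      have hf0 := hpt 0 le_rfl x
      simp only [S12.rS_zero_time hκpos hS (hfnC _), S12.rS_zero_time hκpos hS hfC] at hf0
      exact le_of_tendsto_of_tendsto' (hpt h hh x) (hf0.add_const _) hn
    rw [S12.rS_eq hκpos hS hh hfC]
    simp only [ecoe]
    rw [← EReal.coe_sub]
    have hm : max (((S12.rS S h f x - f x : ℝ)) : EReal) 0
        = ((max (S12.rS S h f x - f x) 0 : ℝ) : EReal) := by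
      rw [EReal.coe_strictMono.monotone.map_max]; rfl
    rw [hm, ← EReal.coe_mul]
    refine EReal.coe_le_coe_iff.2 ?_
    have : max (S12.rS S h f x - f x) 0 ≤ (2 * C + 1) / κ x * h :=
      max_le (by linarith) (by positivity)
    calc max (S12.rS S h f x - f x) 0 * κ x ≤ (2 * C + 1) / κ x * h * κ x :=
          mul_le_mul_of_nonneg_right this hk.le
      _ = (2 * C + 1) * h := by field_simp
  · intro x0
    set G := gammaLimsup (fun n => uppGen S (fn n)) with hGdef
    have hGeq : G = S12.flim atTop (fun n => uppGen S (fn n)) :=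
      funext fun x => S12.gammaLimsup_eq _ x
    have hGUB : S12.UB atTop (fun n => uppGen S (fn n)) G := hGeq ▸ S12.UB_flim _ _
    have hcont : Continuous fun x => ((|r1| / κ x : ℝ) : EReal) :=
      continuous_coe_real_ereal.comp (continuous_const.div hκc fun x => (hκpos x).ne')
    have hGle : ∀ x, G x ≤ ((|r1| / κ x : ℝ) : EReal) := by
      rw [hGeq]
      apply S12.UB.flim_le
      intro x a ha
      filter_upwards [(hcont.continuousAt.eventually_lt_const ha).prod_inr atTop] with p hp
      exact (hgen _ _).trans_lt hp
    have hGusc : UpperSemicontinuous G := hGeq ▸ S12.usc_flim _ _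
    obtain ⟨rf, hrf⟩ := hfC.2
    have hGU : MemUk κ (fun x => ecoe f x + G x) := by
      refine S12.memUk_of hκpos (hsum _ _ hfC.1 hGusc
        fun x => (hGle x).trans_lt (EReal.coe_lt_top _)) (r := |rf| + |r1|) (by positivity) ?_
      intro x
      have := add_le_add (S12.ecoe_le hκpos (S12.CkBound.mono hrf (le_abs_self rf)) x) (hGle x)
      rw [← EReal.coe_add, ← add_div] at this
      exact this
    refine le_of_forall_gt_imp_ge_of_dense fun a ha => ?_
    obtain ⟨M, hGM, hMa⟩ := EReal.lt_iff_exists_real_btwn.1 ha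
    refine le_trans ?_ hMa.le
    obtain ⟨M', hGM', hM'⟩ := EReal.lt_iff_exists_real_btwn.1 hGM
    have hM'M : M' < M := EReal.coe_lt_coe_iff.1 hM'
    have hfst : Tendsto (Prod.fst : ℕ × ℝ → ℕ) (atTop ×ˢ 𝓝[Set.Ici (0:ℝ)] 0) atTop := tendsto_fst
    have hsnd : Tendsto (Prod.snd : ℕ × ℝ → ℝ) (atTop ×ˢ 𝓝[Set.Ici (0:ℝ)] 0)
      (𝓝[Set.Ici (0:ℝ)] 0) := tendsto_snd
    have hk1 := S12.key hκc hκpos hS (l := atTop ×ˢ 𝓝[Set.Ici (0:ℝ)] 0) hR0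
      (Eventually.of_forall fun p : ℕ × ℝ => ⟨hΦU p.1, hΦle p.1⟩) hGU
      ((S12.UB_add hGUB hjoint).comp hfst) le_rfl hsnd x0 ((f x0 + M' : ℝ) : EReal) (by
        rw [hS.idZero _ hGU]
        simp only [ecoe]
        rw [EReal.coe_add]
        exact EReal.add_lt_add_left_coe hGM' _)
    have hk2 := S12.key hκc hκpos hS (l := atTop ×ˢ 𝓝[Set.Ici (0:ℝ)] 0) (abs_nonneg r0)
      (F := fun p : ℕ × ℝ => ecoe (fun y => - fn p.1 y))
      (Eventually.of_forall fun p : ℕ × ℝ => ⟨S12.memUk_ecoe hκpos (S12.memCk_neg (hfnC p.1)),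
        S12.ecoe_le hκpos (fun x => by rw [abs_neg]; exact hbd' p.1 x)⟩)
      (S12.memUk_ecoe hκpos (S12.memCk_neg hfC))
      ((S12.UB_of_tendsto (g := fun n y => - fn n y) (fun x => (hjoint x).neg)).comp hfst)
      le_rfl hsnd x0 ((- f x0 + (M - M') : ℝ) : EReal) (by
        rw [hS.idZero _ (S12.memUk_ecoe hκpos (S12.memCk_neg hfC))]
        exact EReal.coe_lt_coe_iff.2 (by linarith))
    have hk3 : ∀ᶠ p in (atTop ×ˢ 𝓝[Set.Ici (0:ℝ)] 0) ×ˢ 𝓝 x0,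
        S p.1.2 (Φ p.1.1) p.2 < ((M + S12.rS S p.1.2 (fn p.1.1) p.2 : ℝ) : EReal) := by
      have hpos : ∀ᶠ p in (atTop ×ˢ 𝓝[Set.Ici (0:ℝ)] 0) ×ˢ 𝓝 x0, (0:ℝ) ≤ (p : (ℕ × ℝ) × X).1.2 :=
        Eventually.prod_inl (hsnd.eventually eventually_mem_nhdsWithin) (𝓝 x0)
      filter_upwards [hk1, hk2, hpos] with p h1 h2 h3
      refine h1.trans (EReal.coe_lt_coe_iff.2 ?_)
      rw [S12.rS_eq hκpos hS h3 (S12.memCk_neg (hfnC _))] at h2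
      have h4 := EReal.coe_lt_coe_iff.1 h2
      have h5 := S12.rS_neg hκpos hS h3 (hfnC p.1.1) p.2
      linarith
    obtain ⟨pa, hpa, pb, hpb, hh⟩ := eventually_prod_iff.1 hk3
    obtain ⟨pn, hpn, ps, hps, hh2⟩ := eventually_prod_iff.1 hpa
    obtain ⟨δ, hδ, hδ2⟩ := (mem_nhdsGE_iff_exists_Ico_subset).1 hps
    have hδ0 : (0:ℝ) < δ := hδ
    have hfin : ∀ h, 0 ≤ h → h ≤ min δ 1 → ∀ y, pb y → S12.rS S h f y ≤ f y + M * h := by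
      intro h hh0 hh1 y hy
      have hf0 := hpt 0 le_rfl y
      simp only [S12.rS_zero_time hκpos hS (hfnC _), S12.rS_zero_time hκpos hS hfC] at hf0
      refine le_of_tendsto_of_tendsto (hpt h hh0 y) (hf0.add_const _) ?_
      filter_upwards [hpn] with n hn
      refine S12.growth hκc hκpos hS (hfn n) (hΦU n) (fun _ => le_rfl) (min_le_right δ 1) y
        (fun s hs hs1 => ?_) hh0 hh1
      exact hh (hh2 hn (hδ2 ⟨hs, hs1.trans_le (min_le_left _ _)⟩)) hy
    have hle : uppGen S f x0 ≤ S12.flim (𝓝[>] (0:ℝ)) (fun h => diffQuot S f h) x0 :=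
      (S12.gammaLimsupZero_eq _ x0).le
    refine hle.trans (S12.flim_le_of_ev ?_)
    have hI : ∀ᶠ h in 𝓝[>] (0:ℝ), h ∈ Set.Ioc 0 (min δ 1) := Ioc_mem_nhdsGT (lt_min hδ0 one_pos)
    filter_upwards [hI.prod_mk hpb] with p hp
    have h1 := hfin p.1 hp.1.1.le hp.1.2 p.2 hp.2
    have hp0 : 0 < p.1 := hp.1.1
    simp only [diffQuot, S12.rS_eq hκpos hS hp0.le hfC]
    simp only [ecoe]
    rw [← EReal.coe_sub, ← EReal.coe_mul]
    refine EReal.coe_le_coe_iff.2 ?_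
    rw [inv_mul_le_iff₀ hp0]
    linarith
end

section
/- Let (S(t))_{t≥0} satisfy Assumption S. Let (f_n) ⊂ D(A_Γ) be a bounded sequence (sup_n ‖f_n‖_κ < ∞) and f ∈ C_κ with f_n → f in the mixed topology, such that (A_Γf_n) is bounded above. Suppose that for every ε > 0 and compact K ⊂ X there exist n₀ ∈ ℕ, h₀ > 0 and a sequence (r_n) ⊂ (0,∞) with r_n → 0 such that ((S(h)f_n − f_n)/h)(x) ≤ sup_{y : d(x,y) ≤ r_n} ((S(h)f − f)/h)(y) + ε/κ(x) for all h ∈ (0,h₀], n ≥ n₀ and x ∈ K. Then f ∈ D(A_Γ) and A_Γf = Γ-lim_{n→∞} A_Γf_n. -/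
open Filter MeasureTheory Topology
open scoped ENNReal Topology

section aux
variable {X : Type*} [MetricSpace X]

lemma aux_usc_env (G : X → EReal) : UpperSemicontinuous (fun x => limsup G (𝓝 x)) := by
  intro x a ha
  obtain ⟨b, hb1, hb2⟩ := exists_between ha
  have h1 : ∀ᶠ y in 𝓝 x, G y < b := eventually_lt_of_limsup_lt hb1
  filter_upwards [eventually_eventually_nhds.2 h1] with y hy
  refine lt_of_le_of_lt ?_ hb2
  exact limsup_le_of_le (by isBoundedDefault) (hy.mono fun z hz => hz.le)

lemma aux_le_env (G : X → EReal) (x : X) : G x ≤ limsup G (𝓝 x) := by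
  refine le_limsup_of_frequently_le ?_ (by isBoundedDefault)
  intro h
  exact h.self_of_nhds le_rfl

lemma aux_pos_mul {κ : ℝ} (hκ : 0 < κ) {R : ℝ} {z : EReal} (hz : z ≤ ((R / κ : ℝ) : EReal)) :
    max z 0 * (κ : EReal) ≤ ((max R 0 : ℝ) : EReal) := by
  have h1 : max z 0 ≤ ((max (R / κ) 0 : ℝ) : EReal) := by
    refine max_le (hz.trans ?_) ?_
    · exact_mod_cast le_max_left _ _
    · exact_mod_cast le_max_right _ _
  calc max z 0 * (κ : EReal) ≤ ((max (R / κ) 0 : ℝ) : EReal) * (κ : EReal) :=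
        mul_le_mul_of_nonneg_right h1 (by exact_mod_cast hκ.le)
    _ = ((max (R / κ) 0 * κ : ℝ) : EReal) := by rw [EReal.coe_mul]
    _ = ((max R 0 : ℝ) : EReal) := by
        rw [max_mul_of_nonneg _ _ hκ.le, div_mul_cancel₀ _ hκ.ne', zero_mul]

lemma aux_exists_seq {κ : X → ℝ} (hκc : Continuous κ) (hκ : ∀ x, 0 < κ x)
    {J : Type*} {l : Filter J} [l.IsCountablyGenerated]
    (Φ : J → X → ℝ) (ψ : X → ℝ) (hψc : Continuous ψ) (R : ℝ)
    (hΦR : ∀ᶠ j in l, ∀ x, Φ j x * κ x ≤ R) (hψR : ∀ x, ψ x * κ x ≤ R)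
    (hlim : ∀ x, ∀ a > ψ x, ∀ᶠ p in l ×ˢ 𝓝 x, Φ p.1 p.2 < a) :
    ∃ H : ℕ → X → EReal, (∀ k, MemUk κ (H k)) ∧ (∀ x, Antitone fun k => H k x) ∧
      (∀ x, (⨅ k, H k x) = (ψ x : EReal)) ∧
      ∀ k, ∀ᶠ j in l, ∀ x, (Φ j x : EReal) ≤ H k x := by
  obtain ⟨V, hV⟩ := l.exists_antitone_basis
  set E : Set J := {j | ∀ x, Φ j x * κ x ≤ R} with hE
  have hEl : E ∈ l := hΦR
  let G : ℕ → X → EReal := fun k y => max (ψ y : EReal) (⨆ j ∈ V k ∩ E, (Φ j y : EReal))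
  have hGB : ∀ k y, G k y ≤ ((R / κ y : ℝ) : EReal) := by
    intro k y
    refine max_le ?_ (iSup₂_le fun j hj => ?_)
    · exact_mod_cast (le_div_iff₀ (hκ y)).2 (hψR y)
    · exact_mod_cast (le_div_iff₀ (hκ y)).2 (hj.2 y)
  have hHB : ∀ k x, limsup (G k) (𝓝 x) ≤ ((R / κ x : ℝ) : EReal) := by
    intro k x
    have hc : Tendsto (fun y => ((R / κ y : ℝ) : EReal)) (𝓝 x) (𝓝 ((R / κ x : ℝ) : EReal)) :=
      (continuous_coe_real_ereal.comp (continuous_const.div hκc fun y => (hκ y).ne')).tendsto x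
    rw [← hc.limsup_eq]
    exact limsup_le_limsup (Eventually.of_forall (hGB k))
  have hanti : ∀ x, Antitone fun k => limsup (G k) (𝓝 x) := by
    intro x k m hkm
    refine limsup_le_limsup (Eventually.of_forall fun y => ?_)
    refine max_le_max le_rfl ?_
    exact biSup_mono fun j hj => ⟨hV.antitone hkm hj.1, hj.2⟩
  refine ⟨fun k x => limsup (G k) (𝓝 x), ?_, hanti, ?_, ?_⟩
  · intro k
    refine ⟨aux_usc_env _, fun x => (hHB k x).trans_lt (EReal.coe_lt_top _), max R 0, fun x => ?_⟩
    exact aux_pos_mul (hκ x) (hHB k x)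
  · intro x
    refine le_antisymm ?_ (le_iInf fun k => (le_max_left _ _).trans (aux_le_env (G k) x))
    refine le_of_forall_gt_imp_ge_of_dense fun a ha => ?_
    obtain ⟨b, hb1, hb2⟩ := EReal.lt_iff_exists_real_btwn.1 ha
    have hb1' : ψ x < b := by exact_mod_cast hb1
    have h1 := hlim x b hb1'
    obtain ⟨s, hs, t, ht, hst⟩ := Filter.mem_prod_iff.1 h1
    obtain ⟨k, -, hk⟩ := hV.toHasBasis.mem_iff.1 hs
    refine (iInf_le _ k).trans (le_trans ?_ hb2.le)
    refine limsup_le_of_le (by isBoundedDefault) ?_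
    filter_upwards [ht, (hψc.tendsto x).eventually (gt_mem_nhds hb1')] with y hy hy2
    refine max_le (by exact_mod_cast hy2.le) (iSup₂_le fun j hj => ?_)
    have : Φ j y < b := hst (Set.mk_mem_prod (hk hj.1) hy)
    exact_mod_cast this.le
  · intro k
    filter_upwards [hEl, hV.toHasBasis.mem_of_mem (i := k) trivial] with j hj1 hj2 x
    refine le_trans ?_ (aux_le_env (G k) x)
    refine le_trans ?_ (le_max_right _ _)
    exact le_iSup₂_of_le j ⟨hj2, hj1⟩ le_rfl

lemma aux_memUk {κ : X → ℝ} (hκ : ∀ x, 0 < κ x) {f : X → ℝ} (hf : Continuous f) {R : ℝ}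
    (hR : ∀ x, f x * κ x ≤ R) : MemUk κ (ecoe f) := by
  refine ⟨?_, fun x => EReal.coe_lt_top _, max R 0, fun x => ?_⟩
  · exact (continuous_coe_real_ereal.comp hf).upperSemicontinuous
  · refine aux_pos_mul (hκ x) ?_
    exact EReal.coe_le_coe_iff.2 ((le_div_iff₀ (hκ x)).2 (hR x))

lemma aux_ck_uk {κ : X → ℝ} (hκ : ∀ x, 0 < κ x) {f : X → ℝ} (hf : MemCk κ f) :
    MemUk κ (ecoe f) := by
  obtain ⟨hc, r, hr⟩ := hf
  refine aux_memUk hκ hc (R := r) fun x => le_trans ?_ (hr x)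
  exact mul_le_mul_of_nonneg_right (le_abs_self _) (hκ x).le

lemma aux_gammaUsc {κ : X → ℝ} {S : ℝ → (X → EReal) → (X → EReal)} (hS : AssumptionS κ S)
    {H : X → EReal} (hH : MemUk κ H) {t : ℝ} (ht : 0 ≤ t) (x : X) {a : EReal}
    (ha : S t H x < a) :
    ∀ᶠ p : ℝ × X in 𝓝[Set.Ici 0] t ×ˢ 𝓝 x, S p.1 H p.2 < a := by
  by_contra hcon
  obtain ⟨u, hu, hu2⟩ := exists_seq_forall_of_frequently (not_eventually.1 hcon |>.and_eventually
    (tendsto_fst.eventually (eventually_mem_nhdsWithin)))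
  have h1 := hS.gammaUsc t ht H hH x
  have hu1 : Tendsto (fun n => (u n).1) atTop (𝓝 t) :=
    (tendsto_fst.comp hu).mono_right nhdsWithin_le_nhds
  have hu3 : Tendsto (fun n => (u n).2) atTop (𝓝 x) := tendsto_snd.comp hu
  have h2 : limsup (fun n => S (u n).1 H (u n).2) atTop ≤ S t H x := by
    refine le_trans ?_ h1
    refine le_trans ?_ (le_iSup_of_le (fun n => (u n).1) (le_iSup_of_le (fun n => (hu2 n).2)
      (le_iSup_of_le hu1 le_rfl)))
    exact le_iSup_of_le (fun n => (u n).2) (le_iSup_of_le hu3 le_rfl)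
  have h3 : a ≤ limsup (fun n => S (u n).1 H (u n).2) atTop :=
    le_limsup_of_frequently_le
      (Eventually.frequently (Eventually.of_forall fun n => not_lt.1 (hu2 n).1))
      (by isBoundedDefault)
  exact absurd (h3.trans h2) (not_le.2 ha)

/-- real version of the operators -/
noncomputable def auxT (S : ℝ → (X → EReal) → (X → EReal)) (t : ℝ) (f : X → ℝ) (x : X) : ℝ :=
  (S t (ecoe f) x).toReal

lemma aux_fin {κ : X → ℝ} (hκ : ∀ x, 0 < κ x) {z : EReal} {x : X} {C : ℝ≥0∞} (hC : C ≠ ⊤)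
    (h : z.abs * ENNReal.ofReal (κ x) ≤ C) :
    z = (z.toReal : EReal) ∧ |z.toReal| * κ x ≤ C.toReal := by
  have hk : ENNReal.ofReal (κ x) ≠ 0 := by simpa using hκ x
  induction z with
  | bot => simp [ENNReal.top_mul hk] at h; exact absurd h hC
  | top => simp [ENNReal.top_mul hk] at h; exact absurd h hC
  | coe z =>
    refine ⟨rfl, ?_⟩
    rw [EReal.abs_def, ← ENNReal.ofReal_mul (abs_nonneg _)] at h
    simpa using (ENNReal.ofReal_le_iff_le_toReal hC).1 h

lemma auxT_bound {κ : X → ℝ} (hκ : ∀ x, 0 < κ x) {S : ℝ → (X → EReal) → (X → EReal)}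
    (hS : AssumptionS κ S) (r t : ℝ) (hr : 0 ≤ r) (ht : 0 ≤ t) :
    ∃ C : ℝ, 0 ≤ C ∧ ∀ s, 0 ≤ s → s ≤ t → ∀ f : X → ℝ, MemCk κ f → CkBound κ r f →
      CkBound κ C (auxT S s f) := by
  obtain ⟨C, hC, h⟩ := hS.bounded r t hr ht
  refine ⟨C.toReal, ENNReal.toReal_nonneg, fun s hs hst f hf hfr x => ?_⟩
  exact (aux_fin hκ hC ((le_iSup (fun x => (S s (ecoe f) x).abs * ENNReal.ofReal (κ x)) x).trans
    (h s hs hst f hf hfr))).2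

lemma auxT_eq {κ : X → ℝ} (hκ : ∀ x, 0 < κ x) {S : ℝ → (X → EReal) → (X → EReal)}
    (hS : AssumptionS κ S) {t : ℝ} (ht : 0 ≤ t) {f : X → ℝ} (hf : MemCk κ f) :
    S t (ecoe f) = ecoe (auxT S t f) := by
  obtain ⟨hc, r, hr⟩ := id hf
  obtain ⟨C, hC, h⟩ := hS.bounded |r| t (abs_nonneg _) ht
  funext x
  exact (aux_fin hκ hC ((le_iSup (fun x => (S t (ecoe f) x).abs * ENNReal.ofReal (κ x)) x).trans
    (h t ht le_rfl f hf fun x => (hr x).trans (le_abs_self _)))).1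

lemma auxT_usc {κ : X → ℝ} (hκc : Continuous κ) (hκ : ∀ x, 0 < κ x)
    {S : ℝ → (X → EReal) → (X → EReal)} (hS : AssumptionS κ S)
    {J : Type*} {l : Filter J} [l.IsCountablyGenerated]
    (Φ : J → X → ℝ) (ψ : X → ℝ) (hψ : MemCk κ ψ) (R : ℝ)
    (hΦ : ∀ᶠ j in l, MemCk κ (Φ j))
    (hΦR : ∀ᶠ j in l, ∀ x, Φ j x * κ x ≤ R)
    (hlim : ∀ x, ∀ a > ψ x, ∀ᶠ p in l ×ˢ 𝓝 x, Φ p.1 p.2 < a)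
    {t : ℝ} (ht : 0 ≤ t) (x : X) {a : ℝ} (ha : auxT S t ψ x < a) :
    ∀ᶠ p : J × (ℝ × X) in l ×ˢ (𝓝[Set.Ici 0] t ×ˢ 𝓝 x), auxT S p.2.1 (Φ p.1) p.2.2 < a := by
  obtain ⟨hψc, r, hr⟩ := id hψ
  obtain ⟨H, hH1, hH2, hH3, hH4⟩ := aux_exists_seq hκc hκ Φ ψ hψc (max R r)
    (hΦR.mono fun j hj x => (hj x).trans (le_max_left _ _))
    (fun x => ((mul_le_mul_of_nonneg_right (le_abs_self _) (hκ x).le).trans (hr x)).trans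
      (le_max_right _ _)) hlim
  have h1 := hS.contAbove t ht H (ecoe ψ) hH1 (aux_ck_uk hκ hψ) hH2 hH3 x
  have h2 : (⨅ n, S t (H n) x) < (a : EReal) := by
    rw [h1, auxT_eq hκ hS ht hψ]; exact EReal.coe_lt_coe_iff.2 ha
  obtain ⟨k, hk⟩ := iInf_lt_iff.1 h2
  have h3 := aux_gammaUsc hS (hH1 k) ht x hk
  filter_upwards [(hH4 k).and hΦ |>.prod_mk h3, (tendsto_fst.comp tendsto_snd).eventually
    (eventually_mem_nhdsWithin (a := t) (s := Set.Ici (0 : ℝ)))] with p hp hp0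
  replace hp0 : 0 ≤ p.2.1 := hp0
  have h4 := hS.monotone p.2.1 hp0 _ _ (aux_ck_uk hκ hp.1.2) (hH1 k) hp.1.1 p.2.2
  have h5 := h4.trans_lt hp.2
  rw [auxT_eq hκ hS hp0 hp.1.2] at h5
  exact EReal.coe_lt_coe_iff.1 h5

lemma auxCk_comb {κ : X → ℝ} (hκ : ∀ x, 0 < κ x) {f g : X → ℝ} (hf : MemCk κ f) (hg : MemCk κ g)
    (a b : ℝ) : MemCk κ (fun x => a * f x + b * g x) := by
  obtain ⟨hc, r, hr⟩ := hf
  obtain ⟨hc', r', hr'⟩ := hg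
  refine ⟨by fun_prop, |a| * r + |b| * r', fun x => ?_⟩
  have h1 : |a * f x + b * g x| ≤ |a| * |f x| + |b| * |g x| := by
    rw [← abs_mul, ← abs_mul]; exact abs_add_le _ _
  have h2 := mul_le_mul_of_nonneg_left (hr x) (abs_nonneg a)
  have h3 := mul_le_mul_of_nonneg_left (hr' x) (abs_nonneg b)
  have h4 := mul_le_mul_of_nonneg_right h1 (hκ x).le
  nlinarith

lemma auxT_convex {κ : X → ℝ} (hκ : ∀ x, 0 < κ x)
    {S : ℝ → (X → EReal) → (X → EReal)} (hS : AssumptionS κ S) {t : ℝ} (ht : 0 ≤ t)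
    {f g : X → ℝ} (hf : MemCk κ f) (hg : MemCk κ g) {a : ℝ} (ha : 0 ≤ a) (ha1 : a ≤ 1) (x : X) :
    auxT S t (fun y => a * f y + (1 - a) * g y) x ≤ a * auxT S t f x + (1 - a) * auxT S t g x := by
  have h := hS.convex t ht _ _ (aux_ck_uk hκ hf) (aux_ck_uk hκ hg) a ha ha1 x
  rw [auxT_eq hκ hS ht hf, auxT_eq hκ hS ht hg] at h
  have h2 : (fun y => (a : EReal) * ecoe f y + ((1 - a : ℝ) : EReal) * ecoe g y)
      = ecoe (fun y => a * f y + (1 - a) * g y) := by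
    funext y; simp only [ecoe]; push_cast; rfl
  rw [h2, auxT_eq hκ hS ht (auxCk_comb hκ hf hg a (1 - a))] at h
  simp only [ecoe] at h
  exact_mod_cast h

lemma auxT_zero {κ : X → ℝ} 
    {S : ℝ → (X → EReal) → (X → EReal)} (hS : AssumptionS κ S) {t : ℝ} (ht : 0 ≤ t) (x : X) :
    auxT S t (fun _ => 0) x = 0 := by
  have := hS.zero t ht x
  have h2 : (ecoe (fun _ : X => (0 : ℝ))) = fun _ => (0 : EReal) := by funext y; simp [ecoe]
  simp [auxT, h2, this]

lemma auxT_id {κ : X → ℝ} (hκ : ∀ x, 0 < κ x)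
    {S : ℝ → (X → EReal) → (X → EReal)} (hS : AssumptionS κ S) 
    {f : X → ℝ} (hf : MemCk κ f) : auxT S 0 f = f := by
  funext x
  simp [auxT, hS.idZero _ (aux_ck_uk hκ hf), ecoe]

lemma aux_dq {κ : X → ℝ} (hκ : ∀ x, 0 < κ x)
    {S : ℝ → (X → EReal) → (X → EReal)} (hS : AssumptionS κ S) {t : ℝ} (ht : 0 ≤ t)
    {f : X → ℝ} (hf : MemCk κ f) (x : X) :
    diffQuot S f t x = ((t⁻¹ * (auxT S t f x - f x) : ℝ) : EReal) := by
  simp only [diffQuot, auxT_eq hκ hS ht hf, ecoe]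
  push_cast; rfl

lemma auxT_mem {κ : X → ℝ} {S : ℝ → (X → EReal) → (X → EReal)} {f : X → ℝ}
    (hf : UpperLip κ S f) {t : ℝ} (ht : 0 ≤ t) : MemCk κ (auxT S t f) := by
  obtain ⟨g, hg, h⟩ := hf.2.1 t ht
  have : auxT S t f = g := by funext x; simp [auxT, h x]
  rwa [this]

lemma auxT_sg {κ : X → ℝ} (hκ : ∀ x, 0 < κ x)
    {S : ℝ → (X → EReal) → (X → EReal)} (hS : AssumptionS κ S) {f : X → ℝ}
    (hf : UpperLip κ S f) {s t : ℝ} (hs : 0 ≤ s) (ht : 0 ≤ t) :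
    auxT S (s + t) f = auxT S s (auxT S t f) := by
  funext x
  simp only [auxT]
  rw [hf.2.2.1 s t hs ht, auxT_eq hκ hS ht hf.1]

lemma auxT_lip {κ : X → ℝ} (hκ : ∀ x, 0 < κ x)
    {S : ℝ → (X → EReal) → (X → EReal)} (hS : AssumptionS κ S) {f : X → ℝ}
    (hf : UpperLip κ S f) : ∃ h₀ > (0:ℝ), ∃ c ≥ (0:ℝ), ∀ h, 0 ≤ h → h ≤ h₀ → ∀ x,
      (auxT S h f x - f x) * κ x ≤ c * h := by
  obtain ⟨h₀, hh₀, c, hc, H⟩ := hf.2.2.2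
  refine ⟨h₀, hh₀, c, hc, fun h h1 h2 x => ?_⟩
  have h3 := H h h1 h2 x
  rw [auxT_eq hκ hS h1 hf.1] at h3
  have h4 : ((auxT S h f x - f x : ℝ) : EReal) * (κ x : EReal) ≤ ((c * h : ℝ) : EReal) := by
    refine le_trans (mul_le_mul_of_nonneg_right ?_ (by exact_mod_cast (hκ x).le)) h3
    rw [EReal.coe_sub]
    exact le_max_left _ _
  rw [← EReal.coe_mul] at h4
  exact EReal.coe_le_coe_iff.1 h4

lemma aux_core {κ : X → ℝ} (hκc : Continuous κ) (hκ : ∀ x, 0 < κ x)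
    {S : ℝ → (X → EReal) → (X → EReal)} (hS : AssumptionS κ S) {f φ : X → ℝ}
    (hf : UpperLip κ S f) (hφ : MemCk κ φ)
    (hup : ∀ x, ∀ a > φ x, ∀ᶠ p : ℝ × X in 𝓝[>] 0 ×ˢ 𝓝 x,
      p.1⁻¹ * (auxT S p.1 f p.2 - f p.2) < a)
    (y : X) {h A B : ℝ} (hh : 0 < h)
    (hA : ∀ s, 0 ≤ s → s ≤ h → auxT S s (fun x => f x + φ x) y ≤ A)
    (hB : ∀ s, 0 ≤ s → s ≤ h → B ≤ auxT S s f y) :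
    auxT S h f y - f y ≤ h * (A - B) := by
  have hfc : Continuous f := hf.1.1
  have hfφ : MemCk κ (fun x => f x + φ x) := by
    simpa using auxCk_comb hκ hf.1 hφ 1 1
  let Φ : ℝ → X → ℝ := fun η x => f x + η⁻¹ * (auxT S η f x - f x)
  have hΦm : ∀ η, 0 ≤ η → MemCk κ (Φ η) := by
    intro η hη
    have := auxCk_comb hκ hf.1 (auxT_mem hf hη) (1 - η⁻¹) η⁻¹
    convert this using 2 with x
    simp only [Φ]; ring
  obtain ⟨h₀, hh₀, c, hc, hl⟩ := auxT_lip hκ hS hf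
  obtain ⟨-, r, hr⟩ := id hf.1
  have hpos : ∀ᶠ η : ℝ in 𝓝[>] 0, 0 < η := eventually_mem_nhdsWithin
  have hsm : ∀ b : ℝ, 0 < b → ∀ᶠ η : ℝ in 𝓝[>] 0, η < b := fun b hb =>
    nhdsWithin_le_nhds (gt_mem_nhds hb)
  have hΦR : ∀ᶠ η in 𝓝[>] (0:ℝ), ∀ x, Φ η x * κ x ≤ r + c := by
    filter_upwards [hpos, hsm h₀ hh₀] with η h1 h2 x
    have h3 := hl η h1.le h2.le x
    have h4 := (mul_le_mul_of_nonneg_right (le_abs_self (f x)) (hκ x).le).trans (hr x)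
    have h5 : η⁻¹ * ((auxT S η f x - f x) * κ x) ≤ c := by
      rw [inv_mul_le_iff₀ h1]; linarith
    simp only [Φ]
    linarith
  have hlim : ∀ x, ∀ a > f x + φ x, ∀ᶠ p in 𝓝[>] (0:ℝ) ×ˢ 𝓝 x, Φ p.1 p.2 < a := by
    intro x a ha
    filter_upwards [hup x (φ x + (a - (f x + φ x)) / 2) (by linarith),
      tendsto_snd.eventually ((hfc.tendsto x).eventually
        (gt_mem_nhds (show f x < f x + (a - (f x + φ x)) / 2 by linarith)))] with p h1 h2
    simp only [Φ]
    linarith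
  refine le_of_forall_pos_le_add fun ε' hε' => ?_
  set ε := ε' / h with hε
  have hεp : 0 < ε := by positivity
  have key : ∀ᶠ η in 𝓝[>] (0:ℝ), ∀ s ∈ Set.Icc 0 h, auxT S s (Φ η) y < A + ε := by
    refine isCompact_Icc.induction_on (p := fun V : Set ℝ =>
      ∀ᶠ η in 𝓝[>] (0:ℝ), ∀ s ∈ V, auxT S s (Φ η) y < A + ε) ?_ ?_ ?_ ?_
    · simp
    · intro V W hVW hW
      filter_upwards [hW] with η h1 s hs using h1 s (hVW hs)
    · intro V W hV hW
      filter_upwards [hV, hW] with η h1 h2 s hs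
      exact hs.elim (h1 s) (h2 s)
    · intro s hs
      have h1 := auxT_usc hκc hκ hS Φ _ hfφ (r + c) (hpos.mono fun η hη => hΦm η hη.le) hΦR hlim
        hs.1 y (a := A + ε) (lt_of_le_of_lt (hA s hs.1 hs.2) (by linarith))
      have h2 : Tendsto (fun q : ℝ × ℝ => (q.1, (q.2, y))) (𝓝[>] (0:ℝ) ×ˢ 𝓝[Set.Icc 0 h] s)
          (𝓝[>] (0:ℝ) ×ˢ (𝓝[Set.Ici 0] s ×ˢ 𝓝 y)) := by
        refine tendsto_fst.prodMk (Tendsto.prodMk ?_ tendsto_const_nhds)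
        exact tendsto_snd.mono_right (nhdsWithin_mono _ fun z hz => hz.1)
      obtain ⟨P, hP, Q, hQ, hPQ⟩ := Filter.mem_prod_iff.1 (h2.eventually h1)
      refine ⟨Q, hQ, ?_⟩
      filter_upwards [hP] with η hη z hz
      exact hPQ (Set.mk_mem_prod hη hz)
  have hN : Tendsto (fun N : ℕ => h / ((N : ℝ) + 1)) atTop (𝓝[>] 0) := by
    refine tendsto_nhdsWithin_iff.2 ⟨?_, Eventually.of_forall fun N => ?_⟩
    · have := (tendsto_one_div_add_atTop_nhds_zero_nat (𝕜 := ℝ)).const_mul h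
      simpa [div_eq_mul_inv] using this
    · show 0 < h / ((N : ℝ) + 1)
      positivity
  obtain ⟨N, hN1, hN2⟩ := (hN.eventually (key.and (hsm 1 one_pos))).exists
  set η := h / ((N : ℝ) + 1) with hη
  have hηp : 0 < η := by positivity
  have hηh : ((N : ℝ) + 1) * η = h := by rw [hη]; field_simp
  have ind : ∀ i : ℕ, i ≤ N + 1 → auxT S (i * η) f y ≤ f y + i * η * (A + ε - B) := by
    intro i
    induction i with
    | zero => intro _; simp [auxT_id hκ hS hf.1]
    | succ i ih =>
      intro hi
      have hi' : (i : ℝ) ≤ N := by exact_mod_cast Nat.le_of_succ_le_succ hi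
      have ih := ih (by omega)
      have hs0 : 0 ≤ (i : ℝ) * η := by positivity
      have hsh : (i : ℝ) * η ≤ h := by nlinarith
      have e1 : ((i + 1 : ℕ) : ℝ) * η = i * η + η := by push_cast; ring
      have e2 : auxT S η f = fun z => η * Φ η z + (1 - η) * f z := by
        funext z; simp only [Φ]; field_simp; ring
      have h1 := auxT_convex hκ hS hs0 (hΦm η hηp.le) hf.1 hηp.le hN2.le y
      rw [← e2, ← auxT_sg hκ hS hf hs0 hηp.le, ← e1] at h1
      have h2 := hN1 _ ⟨hs0, hsh⟩
      have h3 := hB _ hs0 hsh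
      have h4 := mul_le_mul_of_nonneg_left h2.le hηp.le
      have h5 := mul_le_mul_of_nonneg_left h3 hηp.le
      push_cast
      push_cast at h1
      nlinarith
  have h1 := ind (N + 1) le_rfl
  push_cast at h1
  rw [hηh] at h1
  have h2 : h * ε = ε' := by rw [hε]; field_simp
  nlinarith

/-- mixed convergence -/
structure AuxMix (κ : X → ℝ) (fn : ℕ → X → ℝ) (f : X → ℝ) : Prop where
  mem : ∀ n, MemCk κ (fn n)
  memf : MemCk κ f
  bd : ∃ R, ∀ n, CkBound κ R (fn n)
  conv : ∀ x, ∀ ε > 0, ∀ᶠ p : ℕ × X in atTop ×ˢ 𝓝 x, |fn p.1 p.2 - f p.2| < ε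

lemma AuxMix.const {κ : X → ℝ} {f : X → ℝ} (hf : MemCk κ f) : AuxMix κ (fun _ => f) f := by
  refine ⟨fun _ => hf, hf, ?_, fun x ε hε => Eventually.of_forall fun p => by simpa using hε⟩
  obtain ⟨-, r, hr⟩ := hf
  exact ⟨r, fun _ => hr⟩

lemma AuxMix.comb {κ : X → ℝ} (hκ : ∀ x, 0 < κ x) {fn gn : ℕ → X → ℝ} {f g : X → ℝ}
    (hf : AuxMix κ fn f) (hg : AuxMix κ gn g) (a b : ℝ) :
    AuxMix κ (fun n x => a * fn n x + b * gn n x) (fun x => a * f x + b * g x) := by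
  refine ⟨fun n => auxCk_comb hκ (hf.mem n) (hg.mem n) a b, auxCk_comb hκ hf.memf hg.memf a b,
    ?_, ?_⟩
  · obtain ⟨r, hr⟩ := hf.bd
    obtain ⟨r', hr'⟩ := hg.bd
    refine ⟨|a| * r + |b| * r', fun n x => ?_⟩
    have h1 : |a * fn n x + b * gn n x| ≤ |a| * |fn n x| + |b| * |gn n x| := by
      rw [← abs_mul, ← abs_mul]; exact abs_add_le _ _
    have h2 := mul_le_mul_of_nonneg_left (hr n x) (abs_nonneg a)
    have h3 := mul_le_mul_of_nonneg_left (hr' n x) (abs_nonneg b)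
    have h4 := mul_le_mul_of_nonneg_right h1 (hκ x).le
    nlinarith
  · intro x ε hε
    set M := |a| + |b| + 1 with hM
    have hMp : 0 < M := by positivity
    filter_upwards [hf.conv x (ε / M) (by positivity), hg.conv x (ε / M) (by positivity)] with p h1 h2
    have e : a * fn p.1 p.2 + b * gn p.1 p.2 - (a * f p.2 + b * g p.2)
      = a * (fn p.1 p.2 - f p.2) + b * (gn p.1 p.2 - g p.2) := by ring
    rw [e]
    refine (abs_add_le _ _).trans_lt ?_
    rw [abs_mul, abs_mul]
    have h3 := mul_le_mul_of_nonneg_left h1.le (abs_nonneg a)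
    have h4 := mul_le_mul_of_nonneg_left h2.le (abs_nonneg b)
    have h5 : M * (ε / M) = ε := by field_simp
    have h6 : 0 < ε / M := by positivity
    rw [hM] at h5
    nlinarith

lemma AuxMix.up {κ : X → ℝ} (hκc : Continuous κ) (hκ : ∀ x, 0 < κ x)
    {S : ℝ → (X → EReal) → (X → EReal)} (hS : AssumptionS κ S) {fn : ℕ → X → ℝ} {f : X → ℝ}
    (hf : AuxMix κ fn f) {t : ℝ} (ht : 0 ≤ t) (x : X) {a : ℝ} (ha : auxT S t f x < a) :
    ∀ᶠ p : ℕ × (ℝ × X) in atTop ×ˢ (𝓝[Set.Ici 0] t ×ˢ 𝓝 x),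
      auxT S p.2.1 (fn p.1) p.2.2 < a := by
  obtain ⟨R, hR⟩ := hf.bd
  refine auxT_usc hκc hκ hS fn f hf.memf R (Eventually.of_forall hf.mem)
    (Eventually.of_forall fun n x =>
      (mul_le_mul_of_nonneg_right (le_abs_self _) (hκ x).le).trans (hR n x)) ?_ ht x ha
  intro z b hb
  filter_upwards [hf.conv z ((b - f z) / 2) (by linarith), tendsto_snd.eventually
    ((hf.memf.1.tendsto z).eventually (gt_mem_nhds (show f z < f z + (b - f z) / 2 by linarith)))]
    with p h1 h2
  have := (abs_lt.1 h1).2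
  linarith

lemma AuxMix.up' {κ : X → ℝ} (hκc : Continuous κ) (hκ : ∀ x, 0 < κ x)
    {S : ℝ → (X → EReal) → (X → EReal)} (hS : AssumptionS κ S) {fn : ℕ → X → ℝ} {f : X → ℝ}
    (hf : AuxMix κ fn f) {t : ℝ} (ht : 0 ≤ t) (x : X) {a : ℝ} (ha : auxT S t f x < a) :
    ∀ᶠ p : ℕ × X in atTop ×ˢ 𝓝 x, auxT S t (fn p.1) p.2 < a := by
  have h2 : Tendsto (fun q : ℕ × X => (q.1, (t, q.2))) (atTop ×ˢ 𝓝 x)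
      (atTop ×ˢ (𝓝[Set.Ici 0] t ×ˢ 𝓝 x)) := by
    refine tendsto_fst.prodMk (Tendsto.prodMk ?_ tendsto_snd)
    exact (tendsto_pure_pure (fun _ => t) ()).comp tendsto_const_pure |>.mono_right
      (pure_le_nhdsWithin ht)
  exact h2.eventually (hf.up hκc hκ hS ht x ha)

lemma AuxMix.half {κ : X → ℝ} (hκ : ∀ x, 0 < κ x)
    {S : ℝ → (X → EReal) → (X → EReal)} (hS : AssumptionS κ S) {f g : X → ℝ}
    (hf : MemCk κ f) (hg : MemCk κ g) {t : ℝ} (ht : 0 ≤ t) (x : X) :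
    2 * auxT S t f x ≤ auxT S t g x + auxT S t (fun y => 2 * f y + (-1) * g y) x := by
  have h := auxT_convex hκ hS ht hg (auxCk_comb hκ hf hg 2 (-1)) (a := 1/2) (by norm_num)
    (by norm_num) x
  have e : (fun y => 1/2 * g y + (1 - 1/2) * (2 * f y + (-1) * g y)) = f := by
    funext y; ring
  rw [e] at h
  linarith

lemma AuxMix.ptw {κ : X → ℝ} (hκc : Continuous κ) (hκ : ∀ x, 0 < κ x)
    {S : ℝ → (X → EReal) → (X → EReal)} (hS : AssumptionS κ S) {fn : ℕ → X → ℝ} {f : X → ℝ}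
    (hf : AuxMix κ fn f) {t : ℝ} (ht : 0 ≤ t) (x : X) :
    Tendsto (fun n => auxT S t (fn n) x) atTop (𝓝 (auxT S t f x)) := by
  have hx : Tendsto (fun n : ℕ => (n, x)) atTop (atTop ×ˢ 𝓝 x) :=
    tendsto_id.prodMk tendsto_const_nhds
  have hmix := (AuxMix.const hf.memf).comb hκ hf 2 (-1)
  have e : (fun x => 2 * f x + (-1) * f x) = f := by funext y; ring
  rw [e] at hmix
  refine tendsto_order.2 ⟨fun a ha => ?_, fun a ha => hx.eventually (hf.up' hκc hκ hS ht x ha)⟩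
  have h1 := hx.eventually (hmix.up' hκc hκ hS ht x
    (a := 2 * auxT S t f x - a) (by linarith))
  filter_upwards [h1] with n hn
  have := AuxMix.half hκ hS hf.memf (hf.mem n) ht x
  linarith

lemma AuxMix.cont {κ : X → ℝ} (hκc : Continuous κ) (hκ : ∀ x, 0 < κ x)
    {S : ℝ → (X → EReal) → (X → EReal)} (hS : AssumptionS κ S) {fn : ℕ → X → ℝ} {f : X → ℝ}
    (hf : AuxMix κ fn f) {t : ℝ} (ht : 0 ≤ t) (hc : ∀ n, Continuous (auxT S t (fn n))) :
    Continuous (auxT S t f) := by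
  refine continuous_iff_continuousAt.2 fun x => tendsto_order.2 ⟨fun a ha => ?_, fun a ha => ?_⟩
  · have hmix := hf.comb hκ (AuxMix.const hf.memf) 2 (-1)
    have e : (fun x => 2 * f x + (-1) * f x) = f := by funext y; ring
    rw [e] at hmix
    set ε := (auxT S t f x - a) / 5 with hε
    have hεp : 0 < ε := by simp only [hε]; linarith
    obtain ⟨P, hP, Q, hQ, hPQ⟩ := Filter.mem_prod_iff.1
      (hmix.up' hκc hκ hS ht x (a := auxT S t f x + ε) (by linarith))
    obtain ⟨n, hnP, hn⟩ := (Filter.inter_mem hP ((hf.ptw hκc hκ hS ht x).eventually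
      (lt_mem_nhds (show auxT S t f x - ε < _ by linarith))) |> Filter.nonempty_of_mem)
    filter_upwards [hQ, ((hc n).tendsto x).eventually
      (lt_mem_nhds (show auxT S t (fn n) x - ε < _ by linarith))] with y hy1 hy2
    have h1 := hPQ (Set.mk_mem_prod hnP hy1)
    have h2 := AuxMix.half hκ hS (hf.mem n) hf.memf ht y
    change auxT S t (fun x => 2 * fn n x + (-1) * f x) y < _ at h1
    change _ < auxT S t (fn n) x at hn
    linarith
  · obtain ⟨P, hP, Q, hQ, hPQ⟩ := Filter.mem_prod_iff.1
      ((AuxMix.const hf.memf).up' hκc hκ hS ht x ha)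
    obtain ⟨n, hn⟩ := Filter.nonempty_of_mem hP
    filter_upwards [hQ] with y hy
    exact hPQ (Set.mk_mem_prod hn hy)

lemma AuxMix.map {κ : X → ℝ} (hκc : Continuous κ) (hκ : ∀ x, 0 < κ x)
    {S : ℝ → (X → EReal) → (X → EReal)} (hS : AssumptionS κ S) {fn : ℕ → X → ℝ} {f : X → ℝ}
    (hf : AuxMix κ fn f) {t : ℝ} (ht : 0 ≤ t) (hc : ∀ n, Continuous (auxT S t (fn n))) :
    AuxMix κ (fun n => auxT S t (fn n)) (auxT S t f) := by
  have hcf := hf.cont hκc hκ hS ht hc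
  obtain ⟨R, hR⟩ := hf.bd
  obtain ⟨-, R', hR'⟩ := id hf.memf
  obtain ⟨C, hC, hb⟩ := auxT_bound hκ hS (max (max R R') 0) t (le_max_right _ _) ht
  have hfn : ∀ n, CkBound κ C (auxT S t (fn n)) := fun n =>
    hb t ht le_rfl _ (hf.mem n) fun x =>
      (hR n x).trans ((le_max_left _ _).trans (le_max_left _ _))
  refine ⟨fun n => ⟨hc n, C, hfn n⟩, ⟨hcf, C, hb t ht le_rfl _ hf.memf fun x =>
      (hR' x).trans ((le_max_right _ _).trans (le_max_left _ _))⟩, ⟨C, hfn⟩, fun x ε hε => ?_⟩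
  have hmix := (AuxMix.const hf.memf).comb hκ hf 2 (-1)
  have e : (fun x => 2 * f x + (-1) * f x) = f := by funext y; ring
  rw [e] at hmix
  filter_upwards [hf.up' hκc hκ hS ht x (a := auxT S t f x + ε / 4) (by linarith),
    hmix.up' hκc hκ hS ht x (a := auxT S t f x + ε / 4) (by linarith),
    tendsto_snd.eventually ((hcf.tendsto x).eventually
      (Metric.ball_mem_nhds _ (show 0 < ε / 4 by linarith)))] with p h1 h2 h3
  rw [Real.dist_eq, abs_lt] at h3
  have h4 := AuxMix.half hκ hS hf.memf (hf.mem p.1) ht p.2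
  rw [abs_lt]
  constructor <;> linarith

lemma aux_le_div {k r : ℝ} (hk : 0 < k) {z : EReal} (h : max z 0 * (k : EReal) ≤ (r : EReal)) :
    z ≤ ((r / k : ℝ) : EReal) := by
  have hk0 : (0 : EReal) ≤ (k : EReal) := by exact_mod_cast hk.le
  induction z with
  | bot => exact bot_le
  | top =>
    rw [max_eq_left le_top, EReal.top_mul_coe_of_pos hk] at h
    exact absurd h (not_le.2 (EReal.coe_lt_top _))
  | coe z =>
    have h2 : (z : EReal) * (k : EReal) ≤ r :=
      (mul_le_mul_of_nonneg_right (le_max_left _ _) hk0).trans h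
    rw [← EReal.coe_mul] at h2
    exact EReal.coe_le_coe_iff.2 ((le_div_iff₀ hk).2 (EReal.coe_le_coe_iff.1 h2))

lemma aux_up_of_deriv {S : ℝ → (X → EReal) → (X → EReal)} {f : X → ℝ} {g : X → EReal}
    (hg : IsGammaDeriv S f g) (x : X) {a : EReal} (ha : g x < a) :
    ∀ᶠ p : ℝ × X in 𝓝[>] 0 ×ˢ 𝓝 x, diffQuot S f p.1 p.2 < a := by
  by_contra hcon
  obtain ⟨u, hu, hu2⟩ := exists_seq_forall_of_frequently (not_eventually.1 hcon |>.and_eventually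
    (tendsto_fst.eventually (eventually_mem_nhdsWithin)))
  have hu1 : Tendsto (fun n => (u n).1) atTop (𝓝 0) :=
    (tendsto_fst.comp hu).mono_right nhdsWithin_le_nhds
  have hu3 : Tendsto (fun n => (u n).2) atTop (𝓝 x) := tendsto_snd.comp hu
  have h2 := (hg (fun n => (u n).1) (fun n => (hu2 n).2) hu1 x).1 _ hu3
  have h3 : a ≤ limsup (fun n => diffQuot S f (u n).1 (u n).2) atTop :=
    le_limsup_of_frequently_le
      (Eventually.frequently (Eventually.of_forall fun n => not_lt.1 (hu2 n).1))
      (by isBoundedDefault)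
  exact absurd (h3.trans h2) (not_le.2 ha)

lemma aux_up_real {κ : X → ℝ} (hκ : ∀ x, 0 < κ x)
    {S : ℝ → (X → EReal) → (X → EReal)} (hS : AssumptionS κ S) {f : X → ℝ} {g : X → EReal}
    (hf : MemCk κ f) (hg : IsGammaDeriv S f g) {φ : X → ℝ} (hφ : ∀ x, g x ≤ (φ x : EReal)) :
    ∀ x, ∀ a > φ x, ∀ᶠ p : ℝ × X in 𝓝[>] 0 ×ˢ 𝓝 x,
      p.1⁻¹ * (auxT S p.1 f p.2 - f p.2) < a := by
  intro x a ha
  filter_upwards [aux_up_of_deriv hg x (a := (a : EReal))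
    ((hφ x).trans_lt (EReal.coe_lt_coe_iff.2 ha)),
    tendsto_fst.eventually (eventually_mem_nhdsWithin)] with p h1 h2
  replace h2 : 0 < p.1 := h2
  rw [aux_dq hκ hS h2.le hf] at h1
  exact EReal.coe_lt_coe_iff.1 h1

lemma aux_gammaLim {F : ℕ → X → EReal} {q : X → EReal}
    (up : ∀ x, ∀ a > q x, ∃ δ > 0, ∀ᶠ n in atTop, ∀ y ∈ Metric.ball x δ, F n y ≤ a)
    (lo : ∀ x, ∀ a < q x, ∀ δ > 0, ∀ᶠ n in atTop, ∃ y ∈ Metric.ball x δ, a < F n y) :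
    IsGammaLim F q := by
  intro x
  have h1 : ∀ u : ℕ → X, Tendsto u atTop (𝓝 x) →
      Filter.limsup (fun n => F n (u n)) atTop ≤ q x := by
    intro u hu
    refine le_of_forall_gt_imp_ge_of_dense fun a ha => ?_
    obtain ⟨δ, hδ, h⟩ := up x a ha
    refine limsup_le_of_le (by isBoundedDefault) ?_
    filter_upwards [h, hu.eventually (Metric.ball_mem_nhds x hδ)] with n h1 h2 using h1 _ h2
  refine ⟨h1, ?_⟩
  have key : ∃ u : ℕ → X, Tendsto u atTop (𝓝 x) ∧ ∀ a < q x, ∀ᶠ n in atTop, a < F n (u n) := by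
    rcases eq_or_ne (q x) ⊥ with hq | hq
    · exact ⟨fun _ => x, tendsto_const_nhds, fun a ha => by simp [hq] at ha⟩
    · obtain ⟨a, -, ha, hat⟩ := exists_seq_strictMono_tendsto' (bot_lt_iff_ne_bot.2 hq)
      classical
      let p : ℕ → ℕ → Prop := fun k n => ∃ y ∈ Metric.ball x (1 / ((k : ℝ) + 1)), a k < F n y
      have hp : ∀ k, ∀ᶠ n in atTop, p k n := fun k => lo x (a k) (ha k).2 _ (by positivity)
      let m : ℕ → ℕ := fun n => Nat.findGreatest (fun k => p k n) n
      have hm : Tendsto m atTop atTop := by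
        refine tendsto_atTop.2 fun K => ?_
        filter_upwards [hp K, eventually_ge_atTop K] with n h1 h2
        exact Nat.le_findGreatest h2 h1
      have hpm : ∀ᶠ n in atTop, p (m n) n := by
        filter_upwards [hp 0] with n h1
        exact Nat.findGreatest_spec (P := fun k => p k n) (Nat.zero_le n) h1
      let u : ℕ → X := fun n => if h : p (m n) n then h.choose else x
      have hu : ∀ᶠ n in atTop, u n ∈ Metric.ball x (1 / ((m n : ℝ) + 1)) ∧ a (m n) < F n (u n) := by
        filter_upwards [hpm] with n hn
        have := hn.choose_spec
        simp only [u, dif_pos hn]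
        exact this
      refine ⟨u, ?_, ?_⟩
      · rw [tendsto_iff_dist_tendsto_zero]
        refine squeeze_zero' (Eventually.of_forall fun n => dist_nonneg)
          (hu.mono fun n hn => (Metric.mem_ball.1 hn.1).le) ?_
        exact (tendsto_one_div_add_atTop_nhds_zero_nat (𝕜 := ℝ)).comp hm
      · intro b hb
        filter_upwards [hu, (hat.comp hm).eventually (lt_mem_nhds hb)] with n h1 h2
        exact lt_trans h2 h1.2
  obtain ⟨u, hu, h2⟩ := key
  refine ⟨u, hu, tendsto_order.2 ⟨h2, fun a ha => ?_⟩⟩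
  exact eventually_lt_of_limsup_lt ((h1 u hu).trans_lt ha)

lemma aux_mix_of_unif {κ : X → ℝ} {fn : ℕ → X → ℝ} {f : X → ℝ}
    (hm : ∀ n, MemCk κ (fn n)) (hbd : ∃ r : ℝ, ∀ n, CkBound κ r (fn n)) (hfC : MemCk κ f)
    (hunif : ∀ K : Set X, IsCompact K → TendstoUniformlyOn (fun n => fn n) f atTop K) :
    AuxMix κ fn f := by
  refine ⟨hm, hfC, hbd, fun x ε hε => ?_⟩
  by_contra hcon
  obtain ⟨u, hu, hu2⟩ := exists_seq_forall_of_frequently (not_eventually.1 hcon)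
  have hu1 : Tendsto (fun n => (u n).1) atTop atTop := tendsto_fst.comp hu
  have hu3 : Tendsto (fun n => (u n).2) atTop (𝓝 x) := tendsto_snd.comp hu
  have h := Metric.tendstoUniformlyOn_iff.1 (hunif _ hu3.isCompact_insert_range) ε hε
  obtain ⟨k, hk⟩ := (hu1.eventually h).exists
  have := hk (u k).2 (Set.mem_insert_of_mem _ ⟨k, rfl⟩)
  rw [dist_comm, Real.dist_eq] at this
  exact hu2 k this

lemma aux_upperLip {κ : X → ℝ} (hκc : Continuous κ) (hκ : ∀ x, 0 < κ x)
    {S : ℝ → (X → EReal) → (X → EReal)} (hS : AssumptionS κ S)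
    {fn : ℕ → X → ℝ} {g : ℕ → X → EReal} {f : X → ℝ}
    (hfnLip : ∀ n, UpperLip κ S (fn n)) (hfnD : ∀ n, IsGammaDeriv S (fn n) (g n))
    (hmix : AuxMix κ fn f)
    (hgbd : ∃ r : ℝ, ∀ n x, max (g n x) 0 * (κ x : EReal) ≤ (r : EReal)) :
    UpperLip κ S f := by
  have hc : ∀ t, 0 ≤ t → ∀ n, Continuous (auxT S t (fn n)) := fun t ht n => (auxT_mem (hfnLip n) ht).1
  have hT : ∀ t, 0 ≤ t → AuxMix κ (fun n => auxT S t (fn n)) (auxT S t f) := fun t ht =>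
    hmix.map hκc hκ hS ht (hc t ht)
  refine ⟨hmix.memf, fun t ht => ⟨auxT S t f, (hT t ht).memf, fun x => ?_⟩, ?_, ?_⟩
  · rw [auxT_eq hκ hS ht hmix.memf]; rfl
  · intro s t hs ht
    rw [auxT_eq hκ hS ht hmix.memf, auxT_eq hκ hS hs (hT t ht).memf,
      auxT_eq hκ hS (add_nonneg hs ht) hmix.memf]
    congr 1
    funext x
    refine tendsto_nhds_unique (hmix.ptw hκc hκ hS (add_nonneg hs ht) x) ?_
    have := (hT t ht).ptw hκc hκ hS hs x
    refine this.congr fun n => ?_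
    rw [auxT_sg hκ hS (hfnLip n) hs ht]
  · obtain ⟨r, hr⟩ := hgbd
    obtain ⟨R, hR⟩ := hmix.bd
    obtain ⟨C, hC, hb⟩ := auxT_bound hκ hS (|R| + |r|) 1 (by positivity) zero_le_one
    have hφ : MemCk κ (fun x => |r| / κ x) := by
      refine ⟨continuous_const.div hκc fun x => (hκ x).ne', |r|, fun x => ?_⟩
      rw [abs_of_nonneg (div_nonneg (abs_nonneg _) (hκ x).le), div_mul_cancel₀ _ (hκ x).ne']
    refine ⟨1, one_pos, 2 * C, by positivity, fun h h0 h1 x => ?_⟩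
    have main : auxT S h f x - f x ≤ (2 * C * h) / κ x := by
      rcases h0.eq_or_lt with h00 | h00
      · rw [← h00, auxT_id hκ hS hmix.memf]; simp
      have hn : ∀ n, auxT S h (fn n) x - fn n x ≤ (2 * C * h) / κ x := by
        intro n
        have hsum : MemCk κ (fun x => fn n x + |r| / κ x) := by
          simpa using auxCk_comb hκ (hmix.mem n) hφ 1 1
        have hsumb : CkBound κ (|R| + |r|) (fun x => fn n x + |r| / κ x) := by
          intro y
          have h2 := abs_add_le (fn n y) (|r| / κ y)
          rw [abs_of_nonneg (div_nonneg (abs_nonneg r) (hκ y).le)] at h2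
          have h3 := mul_le_mul_of_nonneg_right h2 (hκ y).le
          rw [add_mul, div_mul_cancel₀ _ (hκ y).ne'] at h3
          have h4 := (hR n y).trans (le_abs_self R)
          show |fn n y + |r| / κ y| * κ y ≤ _
          linarith
        have hfb : CkBound κ (|R| + |r|) (fn n) := fun y =>
          ((hR n y).trans (le_abs_self R)).trans (by linarith [abs_nonneg r])
        have := aux_core hκc hκ hS (hfnLip n) hφ
          (aux_up_real hκ hS (hmix.mem n) (hfnD n) (fun y => (aux_le_div (hκ y) (hr n y)).trans
            (EReal.coe_le_coe_iff.2 (div_le_div_of_nonneg_right (le_abs_self r) (hκ y).le))))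
          x (A := C / κ x) (B := - (C / κ x)) h00
          (fun s hs hsh => by
            rw [le_div_iff₀ (hκ x)]
            exact (mul_le_mul_of_nonneg_right (le_abs_self _) (hκ x).le).trans
              (hb s hs (hsh.trans h1) _ hsum hsumb x))
          (fun s hs hsh => by
            rw [neg_le, le_div_iff₀ (hκ x)]
            exact (mul_le_mul_of_nonneg_right (neg_le_abs _) (hκ x).le).trans
              (hb s hs (hsh.trans h1) _ (hmix.mem n) hfb x))
        refine this.trans (le_of_eq ?_)
        ring
      have h0t := hmix.ptw hκc hκ hS le_rfl x
      rw [auxT_id hκ hS hmix.memf] at h0t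
      have h0t' : Tendsto (fun n => fn n x) atTop (𝓝 (f x)) :=
        h0t.congr fun n => by rw [auxT_id hκ hS (hmix.mem n)]
      exact le_of_tendsto ((hmix.ptw hκc hκ hS h0 x).sub h0t') (Eventually.of_forall hn)
    have h2 : S h (ecoe f) x - (f x : EReal) ≤ ((2 * C * h / κ x : ℝ) : EReal) := by
      rw [auxT_eq hκ hS h0 hmix.memf]
      simp only [ecoe]
      rw [← EReal.coe_sub]
      exact EReal.coe_le_coe_iff.2 main
    have h3 := aux_pos_mul (hκ x) h2
    rwa [max_eq_left (show (0:ℝ) ≤ 2 * C * h by positivity)] at h3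

lemma aux_alpha {κ : X → ℝ} (hκc : Continuous κ) (hκ : ∀ x, 0 < κ x) (hκbd : ∃ C, ∀ x, κ x ≤ C)
    {S : ℝ → (X → EReal) → (X → EReal)} (hS : AssumptionS κ S)
    {fn : ℕ → X → ℝ} {g : ℕ → X → EReal} {f : X → ℝ}
    (hfnLip : ∀ n, UpperLip κ S (fn n)) (hfnD : ∀ n, IsGammaDeriv S (fn n) (g n))
    (hmix : AuxMix κ fn f)
    (hgbd : ∃ r : ℝ, ∀ n x, max (g n x) 0 * (κ x : EReal) ≤ (r : EReal))
    (x : X) (a δ ε : ℝ) (hδ : 0 < δ) (hε : 0 < ε)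
    (hfr : ∃ᶠ n in atTop, ∀ y ∈ Metric.ball x δ, g n y ≤ (a : EReal)) :
    ∀ᶠ p : ℝ × X in 𝓝[>] 0 ×ˢ 𝓝 x, diffQuot S f p.1 p.2 ≤ ((a + ε : ℝ) : EReal) := by
  obtain ⟨r, hr⟩ := hgbd
  obtain ⟨M, hM⟩ := hκbd
  let φ : X → ℝ := fun y => a + |r / κ y - a| * min 1 (dist y x / δ)
  have hmin0 : ∀ y, 0 ≤ min 1 (dist y x / δ) := fun y => le_min zero_le_one (by positivity)
  have hφc : Continuous φ := by
    have : Continuous fun y => r / κ y := continuous_const.div hκc fun y => (hκ y).ne'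
    fun_prop
  have hφm : MemCk κ φ := by
    refine ⟨hφc, 2 * |a| * M + |r|, fun y => ?_⟩
    have h1 : |φ y| ≤ |a| + |r / κ y - a| := by
      refine (abs_add_le _ _).trans ?_
      rw [abs_mul, abs_abs, abs_of_nonneg (hmin0 y)]
      have := mul_le_mul_of_nonneg_left (min_le_left 1 (dist y x / δ)) (abs_nonneg (r / κ y - a))
      linarith
    have h2 : |r / κ y - a| ≤ |r| / κ y + |a| := by
      refine (abs_sub _ _).trans ?_
      rw [abs_div, abs_of_pos (hκ y)]
    have h3 : |φ y| ≤ 2 * |a| + |r| / κ y := by linarith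
    have h4 := mul_le_mul_of_nonneg_right h3 (hκ y).le
    rw [add_mul, div_mul_cancel₀ _ (hκ y).ne'] at h4
    have h5 := mul_le_mul_of_nonneg_left (hM y) (show 0 ≤ 2 * |a| by positivity)
    linarith
  have hφx : φ x = a := by simp [φ]
  have hgφ : ∀ n, (∀ y ∈ Metric.ball x δ, g n y ≤ (a : EReal)) → ∀ y, g n y ≤ (φ y : EReal) := by
    intro n hn y
    by_cases hy : y ∈ Metric.ball x δ
    · refine (hn y hy).trans (EReal.coe_le_coe_iff.2 ?_)
      have := mul_nonneg (abs_nonneg (r / κ y - a)) (hmin0 y)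
      simp only [φ]; linarith
    · refine (aux_le_div (hκ y) (hr n y)).trans (EReal.coe_le_coe_iff.2 ?_)
      have h1 : min 1 (dist y x / δ) = 1 := by
        rw [min_eq_left]
        rw [le_div_iff₀ hδ, one_mul]
        simpa using hy
      simp only [φ, h1]
      linarith [le_abs_self (r / κ y - a)]
  have hm1 := hmix.comb hκ (AuxMix.const hφm) 1 1
  have hm2 := hmix.comb hκ (AuxMix.const hφm) (-1) 0
  simp only [one_mul] at hm1
  simp only [zero_mul, add_zero] at hm2
  have hu1 := hm1.up hκc hκ hS le_rfl x (a := f x + a + ε / 2) (by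
    rw [auxT_id hκ hS hm1.memf]; show f x + φ x < _; rw [hφx]; linarith)
  have hu2 := hm2.up hκc hκ hS le_rfl x (a := - f x + ε / 2) (by
    rw [auxT_id hκ hS hm2.memf]; linarith)
  obtain ⟨P, hP, Q, hQ, hPQ⟩ := Filter.mem_prod_iff.1 (hu1.and hu2)
  obtain ⟨Q1, hQ1, Q2, hQ2, hQ12⟩ := Filter.mem_prod_iff.1 hQ
  obtain ⟨b, hb, hbQ⟩ := mem_nhdsGE_iff_exists_Ico_subset.1 hQ1
  have hb : 0 < b := hb
  have hbev : ∀ᶠ h in 𝓝[>] (0:ℝ), 0 < h ∧ h < b :=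
    (eventually_mem_nhdsWithin).and (nhdsWithin_le_nhds (gt_mem_nhds hb))
  filter_upwards [hbev.prod_mk (show ∀ᶠ y in 𝓝 x, y ∈ Q2 from hQ2)] with p hp
  obtain ⟨⟨hp0, hpb⟩, hpy⟩ := hp
  have hfreq : ∃ᶠ n in atTop, auxT S p.1 (fn n) p.2 - fn n p.2 ≤ p.1 * (a + ε) := by
    refine (hfr.and_eventually hP).mono fun n hn => ?_
    have hall : ∀ s, 0 ≤ s → s ≤ p.1 →
        auxT S s (fun y => fn n y + φ y) p.2 < f x + a + ε / 2 ∧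
        auxT S s (fun y => -1 * fn n y) p.2 < - f x + ε / 2 := fun s hs hsp =>
      hPQ (Set.mk_mem_prod hn.2 (hQ12 (Set.mk_mem_prod (hbQ ⟨hs, hsp.trans_lt hpb⟩) hpy)))
    have := aux_core hκc hκ hS (hfnLip n) hφm
      (aux_up_real hκ hS (hmix.mem n) (hfnD n) (hgφ n hn.1)) p.2 (A := f x + a + ε / 2)
      (B := f x - ε / 2) hp0 (fun s hs hsp => (hall s hs hsp).1.le) (fun s hs hsp => by
        have h1 := (hall s hs hsp).2
        have h2 := auxT_convex hκ hS hs (hmix.mem n) (hm2.mem n) (a := 1/2) (by norm_num)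
          (by norm_num) p.2
        have e : (fun y => 1/2 * fn n y + (1 - 1/2) * (-1 * fn n y)) = fun _ => 0 := by
          funext y; ring
        rw [e, auxT_zero hS hs] at h2
        linarith)
    refine this.trans (le_of_eq ?_)
    ring
  have h0t := hmix.ptw hκc hκ hS le_rfl p.2
  rw [auxT_id hκ hS hmix.memf] at h0t
  have h0t' : Tendsto (fun n => fn n p.2) atTop (𝓝 (f p.2)) :=
    h0t.congr fun n => by rw [auxT_id hκ hS (hmix.mem n)]
  have hfin := le_of_tendsto_of_frequently ((hmix.ptw hκc hκ hS hp0.le p.2).sub h0t') hfreq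
  rw [aux_dq hκ hS hp0.le hmix.memf]
  refine EReal.coe_le_coe_iff.2 ?_
  rwa [inv_mul_le_iff₀ hp0]

lemma aux_beta {κ : X → ℝ} (hκc : Continuous κ) (hκ : ∀ x, 0 < κ x)
    {S : ℝ → (X → EReal) → (X → EReal)}
    {fn : ℕ → X → ℝ} {g : ℕ → X → EReal} {f : X → ℝ}
    (hfnD : ∀ n, IsGammaDeriv S (fn n) (g n))
    (hlb : ∀ ε > (0:ℝ), ∀ K : Set X, IsCompact K →
      ∃ n₀ : ℕ, ∃ h₀ > (0:ℝ), ∃ rs : ℕ → ℝ, (∀ n, 0 < rs n) ∧ Tendsto rs atTop (𝓝 (0:ℝ)) ∧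
        ∀ h, 0 < h → h ≤ h₀ → ∀ n ≥ n₀, ∀ x ∈ K,
          diffQuot S (fn n) h x ≤
            (⨆ y ∈ Metric.closedBall x (rs n), diffQuot S f h y) + ((ε / κ x : ℝ) : EReal))
    (x : X) (a a' δ : ℝ) (haa : a' < a) (hδ : 0 < δ)
    (hP : ∀ δ > 0, ∃ᶠ n in atTop, ∃ y ∈ Metric.ball x δ, (a : EReal) < g n y) :
    ∀ᶠ h in 𝓝[>] (0:ℝ), ∃ y ∈ Metric.ball x δ, (a' : EReal) < diffQuot S f h y := by
  by_contra hcon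
  obtain ⟨h, hh, hh2⟩ := exists_seq_forall_of_frequently (not_eventually.1 hcon |>.and_eventually
    (eventually_mem_nhdsWithin))
  have hh0 : Tendsto h atTop (𝓝 0) := hh.mono_right nhdsWithin_le_nhds
  have hfreq : ∃ᶠ q : ℕ × (ℕ × X) in atTop ×ˢ (atTop ×ˢ 𝓝 x),
      (a : EReal) < diffQuot S (fn q.1) (h q.2.1) q.2.2 := by
    intro hev
    obtain ⟨P, hP', Q, hQ, hPQ⟩ := Filter.mem_prod_iff.1 hev
    obtain ⟨Q1, hQ1, Q2, hQ2, hQ12⟩ := Filter.mem_prod_iff.1 hQ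
    obtain ⟨δ', hδ', hb⟩ := Metric.mem_nhds_iff.1 hQ2
    obtain ⟨n, ⟨y, hy, hay⟩, hn⟩ := ((hP δ' hδ').and_eventually hP').exists
    obtain ⟨u, hu, hu2⟩ := (hfnD n h (fun k => (hh2 k).2) hh0 y).2
    obtain ⟨k, hk1, hk2, hk3⟩ := ((hu2.eventually (lt_mem_nhds hay)).and
      ((hu.eventually (Metric.isOpen_ball.mem_nhds hy)).and hQ1)).exists
    exact hPQ (Set.mk_mem_prod hn (hQ12 (Set.mk_mem_prod hk3 (hb hk2)))) hk1
  obtain ⟨q, hq, hq2⟩ := exists_seq_forall_of_frequently hfreq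
  have hqn : Tendsto (fun j => (q j).1) atTop atTop := tendsto_fst.comp hq
  have hqk : Tendsto (fun j => (q j).2.1) atTop atTop := (tendsto_fst.comp tendsto_snd).comp hq
  have hqz : Tendsto (fun j => (q j).2.2) atTop (𝓝 x) := (tendsto_snd.comp tendsto_snd).comp hq
  set ε := κ x * (a - a') / 2 with hε
  have hεp : 0 < ε := by
    have := mul_pos (hκ x) (sub_pos.2 haa)
    positivity
  obtain ⟨n₀, h₀, hh₀, rs, hrs, hrs0, H⟩ := hlb ε hεp _ hqz.isCompact_insert_range
  have hεκ : Tendsto (fun j => ε / κ (q j).2.2) atTop (𝓝 (ε / κ x)) :=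
    ((continuous_const.div hκc fun y => (hκ y).ne').tendsto x).comp hqz
  have hlt : ε / κ x < a - a' := by
    rw [div_lt_iff₀ (hκ x), hε]
    have := mul_pos (hκ x) (sub_pos.2 haa)
    linarith
  obtain ⟨j, hj1, hj2, hj3, hj4, hj5⟩ := ((hqn.eventually (eventually_ge_atTop n₀)).and
    (((hh0.comp hqk).eventually (gt_mem_nhds hh₀)).and
    ((hqz.eventually (Metric.ball_mem_nhds x (half_pos hδ))).and
    (((hrs0.comp hqn).eventually (gt_mem_nhds (half_pos hδ))).and
    (hεκ.eventually (gt_mem_nhds hlt)))))).exists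
  have h1 := H (h (q j).2.1) (hh2 _).2 hj2.le (q j).1 hj1 (q j).2.2
    (Set.mem_insert_of_mem _ ⟨j, rfl⟩)
  have h2 : (⨆ y ∈ Metric.closedBall (q j).2.2 (rs (q j).1), diffQuot S f (h (q j).2.1) y)
      ≤ (a' : EReal) := by
    refine iSup₂_le fun y hy => ?_
    have h3 := (hh2 (q j).2.1).1
    push Not at h3
    refine h3 y ?_
    rw [Metric.mem_closedBall] at hy
    rw [Metric.mem_ball]
    have h4 := dist_triangle y (q j).2.2 x
    have h5 : dist (q j).2.2 x < δ / 2 := hj3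
    have h6 : rs (q j).1 < δ / 2 := hj4
    linarith
  have h3 := (hq2 j).trans_le (h1.trans (add_le_add_left h2 _))
  rw [← EReal.coe_add] at h3
  have h4 := EReal.coe_lt_coe_iff.1 h3
  linarith

lemma aux_main {κ : X → ℝ} (hκc : Continuous κ) (hκ : ∀ x, 0 < κ x) (hκbd : ∃ C, ∀ x, κ x ≤ C)
    {S : ℝ → (X → EReal) → (X → EReal)} (hS : AssumptionS κ S)
    {fn : ℕ → X → ℝ} {g : ℕ → X → EReal} {f : X → ℝ}
    (hfnLip : ∀ n, UpperLip κ S (fn n)) (hfnD : ∀ n, IsGammaDeriv S (fn n) (g n))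
    (hmix : AuxMix κ fn f)
    (hgbd : ∃ r : ℝ, ∀ n x, max (g n x) 0 * (κ x : EReal) ≤ (r : EReal))
    (hlb : ∀ ε > (0:ℝ), ∀ K : Set X, IsCompact K →
      ∃ n₀ : ℕ, ∃ h₀ > (0:ℝ), ∃ rs : ℕ → ℝ, (∀ n, 0 < rs n) ∧ Tendsto rs atTop (𝓝 (0:ℝ)) ∧
        ∀ h, 0 < h → h ≤ h₀ → ∀ n ≥ n₀, ∀ x ∈ K,
          diffQuot S (fn n) h x ≤
            (⨆ y ∈ Metric.closedBall x (rs n), diffQuot S f h y) + ((ε / κ x : ℝ) : EReal)) :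
    ∃ gf : X → EReal, IsGammaDeriv S f gf ∧ IsGammaLim g gf := by
  let P : X → ℝ → Prop := fun x a =>
    ∀ δ > 0, ∃ᶠ n in atTop, ∃ y ∈ Metric.ball x δ, (a : EReal) < g n y
  have PW : ∀ x a a', P x a → a' < a → ∀ δ > 0,
      ∀ᶠ h in 𝓝[>] (0:ℝ), ∃ y ∈ Metric.ball x δ, (a' : EReal) < diffQuot S f h y :=
    fun x a a' h haa δ hδ => aux_beta hκc hκ hfnD hlb x a a' δ haa hδ h
  have nQ : ∀ (x : X) (a a' δ : ℝ), 0 < δ → a < a' →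
      (¬ ∀ᶠ n in atTop, ∃ y ∈ Metric.ball x δ, (a : EReal) < g n y) →
      ∀ᶠ p : ℝ × X in 𝓝[>] 0 ×ˢ 𝓝 x, diffQuot S f p.1 p.2 ≤ (a' : EReal) := by
    intro x a a' δ hδ haa hn
    have h1 := aux_alpha hκc hκ hκbd hS hfnLip hfnD hmix hgbd x a δ (a' - a) hδ (by linarith)
      ((not_eventually.1 hn).mono fun n h => by push Not at h; exact h)
    simpa using h1
  have PQ : ∀ x a a', P x a → a' < a → ∀ δ > 0,
      ∀ᶠ n in atTop, ∃ y ∈ Metric.ball x δ, (a' : EReal) < g n y := by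
    intro x a a' h haa δ hδ
    by_contra hn
    obtain ⟨b, hb1, hb2⟩ := exists_between haa
    have h1 := nQ x a' b δ hδ hb1 hn
    obtain ⟨U, hU, V, hV, hUV⟩ := Filter.mem_prod_iff.1 h1
    obtain ⟨δ', hδ', hb⟩ := Metric.mem_nhds_iff.1 hV
    obtain ⟨t, ⟨y, hy, hy2⟩, ht⟩ := ((PW x a b h hb2 δ' hδ').and hU).exists
    exact absurd hy2 (not_lt.2 (hUV (Set.mk_mem_prod ht (hb hy))))
  let gf : X → EReal := fun x => ⨆ (a : ℝ) (_ : P x a), (a : EReal)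
  have hlt : ∀ x, ∀ b < gf x, ∃ a a' : ℝ, P x a ∧ a' < a ∧ b < a' := by
    intro x b hb
    obtain ⟨a, ha⟩ := lt_iSup_iff.1 hb
    obtain ⟨hPa, ha⟩ := lt_iSup_iff.1 ha
    obtain ⟨a', h1, h2⟩ := EReal.lt_iff_exists_real_btwn.1 ha
    exact ⟨a, a', hPa, EReal.coe_lt_coe_iff.1 h2, h1⟩
  have hgt : ∀ x, ∀ b > gf x, ∃ a a' : ℝ, ¬ P x a ∧ a < a' ∧ (a' : EReal) < b := by
    intro x b hb
    obtain ⟨a', h1, h2⟩ := EReal.lt_iff_exists_real_btwn.1 hb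
    obtain ⟨a, h3, h4⟩ := EReal.lt_iff_exists_real_btwn.1 h1
    refine ⟨a, a', fun hPa => ?_, EReal.coe_lt_coe_iff.1 h4, h2⟩
    exact absurd (le_iSup₂_of_le (f := fun (a : ℝ) (_ : P x a) => (a : EReal)) a hPa le_rfl)
      (not_le.2 h3)
  refine ⟨gf, fun h hpos h0 => ?_, ?_⟩
  · have hh : Tendsto h atTop (𝓝[>] 0) :=
      tendsto_nhdsWithin_iff.2 ⟨h0, Eventually.of_forall hpos⟩
    refine aux_gammaLim (fun x b hb => ?_) (fun x b hb δ hδ => ?_)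
    · obtain ⟨a, a', hPa, haa, hab⟩ := hgt x b hb
      have h1 : ∃ δ > 0, ¬ ∃ᶠ n in atTop, ∃ y ∈ Metric.ball x δ, (a : EReal) < g n y := by
        by_contra hc
        push Not at hc
        exact hPa fun δ hδ => hc δ hδ
      obtain ⟨δ, hδ, h1⟩ := h1
      have h2 := nQ x a a' δ hδ haa fun hc => h1 hc.frequently
      obtain ⟨U, hU, V, hV, hUV⟩ := Filter.mem_prod_iff.1 h2
      obtain ⟨δ', hδ', hb⟩ := Metric.mem_nhds_iff.1 hV
      refine ⟨δ', hδ', ?_⟩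
      filter_upwards [hh.eventually hU] with n hn y hy
      exact (hUV (Set.mk_mem_prod hn (hb hy)) : _ ≤ (a' : EReal)).trans hab.le
    · obtain ⟨a, a', hPa, haa, hab⟩ := hlt x b hb
      filter_upwards [hh.eventually (PW x a a' hPa haa δ hδ)] with n hn
      obtain ⟨y, hy, hy2⟩ := hn
      exact ⟨y, hy, hab.trans hy2⟩
  · refine aux_gammaLim (fun x b hb => ?_) (fun x b hb δ hδ => ?_)
    · obtain ⟨a, a', hPa, haa, hab⟩ := hgt x b hb
      have h1 : ∃ δ > 0, ¬ ∃ᶠ n in atTop, ∃ y ∈ Metric.ball x δ, (a : EReal) < g n y := by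
        by_contra hc
        push Not at hc
        exact hPa fun δ hδ => hc δ hδ
      obtain ⟨δ, hδ, h1⟩ := h1
      refine ⟨δ, hδ, ?_⟩
      filter_upwards [not_frequently.1 h1] with n hn y hy
      push Not at hn
      exact (hn y hy).trans (((EReal.coe_lt_coe_iff.2 haa).trans hab).le)
    · obtain ⟨a, a', hPa, haa, hab⟩ := hlt x b hb
      filter_upwards [PQ x a a' hPa haa δ hδ] with n hn
      obtain ⟨y, hy, hy2⟩ := hn
      exact ⟨y, hy, hab.trans hy2⟩

end aux

/-- approximation of the `Γ`-generator. -/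
theorem stmt13
    {X : Type*} [MetricSpace X] [CompleteSpace X] [TopologicalSpace.SeparableSpace X]
    (κ : X → ℝ) (hκc : Continuous κ) (hκpos : ∀ x, 0 < κ x) (hκbd : ∃ C, ∀ x, κ x ≤ C)
    (S : ℝ → (X → EReal) → (X → EReal)) (hS : AssumptionS κ S)
    (fn : ℕ → X → ℝ) (g : ℕ → X → EReal) (f : X → ℝ)
    (hfnLip : ∀ n, UpperLip κ S (fn n))
    (hfnD : ∀ n, IsGammaDeriv S (fn n) (g n))
    (hgU : ∀ n, MemUk κ (g n))
    (hbd : ∃ r : ℝ, ∀ n, CkBound κ r (fn n))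
    (hfC : MemCk κ f)
    (hunif : ∀ K : Set X, IsCompact K → TendstoUniformlyOn (fun n => fn n) f atTop K)
    (hgbd : ∃ r : ℝ, ∀ n x, max (g n x) 0 * (κ x : EReal) ≤ (r : EReal))
    (hlb : ∀ ε > (0:ℝ), ∀ K : Set X, IsCompact K →
      ∃ n₀ : ℕ, ∃ h₀ > (0:ℝ), ∃ rs : ℕ → ℝ, (∀ n, 0 < rs n) ∧ Tendsto rs atTop (𝓝 (0:ℝ)) ∧
        ∀ h, 0 < h → h ≤ h₀ → ∀ n ≥ n₀, ∀ x ∈ K,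
          diffQuot S (fn n) h x ≤
            (⨆ y ∈ Metric.closedBall x (rs n), diffQuot S f h y) + ((ε / κ x : ℝ) : EReal)) :
    UpperLip κ S f ∧ ∃ gf : X → EReal, IsGammaDeriv S f gf ∧ IsGammaLim g gf := by
  have hmix : AuxMix κ fn f := aux_mix_of_unif (fun n => (hfnLip n).1) hbd hfC hunif
  exact ⟨aux_upperLip hκc hκpos hS hfnLip hfnD hmix hgbd,
    aux_main hκc hκpos hκbd hS hfnLip hfnD hmix hgbd hlb⟩
end
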